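/- arXiv:2001.08200 — 7 statements merged into one kernel-verified Lean document; each statement's English description precedes it below -/
import Mathlib

section
/- Let A be a d×d real matrix, B an n×d real matrix, c ∈ ℝⁿ, and suppose the polytope P = {x ∈ ℝᵈ : Bx ≤ c componentwise} is compact. Then there exists a point x₀ ∈ P such that Aⁿ·x₀ ∈ P for all n ∈ ℕ if and only if there exists a point y ∈ P with Ay = y. -/
/-- **Discrete Polytope Escape Problem, fixed point characterization.**
For a compact polytope `P = {x | Bx ≤ c}`, there is a trapped point
(one whose whole discrete orbit `n ↦ Aⁿx₀` stays in `P`) iff `P` contains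
a fixed point `y` with `Ay = y`. -/
theorem dpep_trapped_iff_fixed (d n : ℕ)
    (A : Matrix (Fin d) (Fin d) ℝ) (B : Matrix (Fin n) (Fin d) ℝ) (c : Fin n → ℝ)
    (P : Set (Fin d → ℝ)) (hP : P = {x : Fin d → ℝ | ∀ i, B.mulVec x i ≤ c i})
    (hcompact : IsCompact P) :
    (∃ x₀ ∈ P, ∀ m : ℕ, (A ^ m).mulVec x₀ ∈ P) ↔ (∃ y ∈ P, A.mulVec y = y) := by
  constructor
  · rintro ⟨x₀, -, hx⟩
    have hconv : Convex ℝ P := by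
      subst hP
      intro x hx y hy a b ha hb hab i
      have h1 := mul_le_mul_of_nonneg_left (hx i) ha
      have h2 := mul_le_mul_of_nonneg_left (hy i) hb
      have h3 : a * c i + b * c i = c i := by rw [← add_mul, hab, one_mul]
      simp only [Matrix.mulVec_add, Matrix.mulVec_smul, Pi.add_apply, Pi.smul_apply, smul_eq_mul]
      linarith
    let a : ℕ → (Fin d → ℝ) := fun N =>
      ∑ k ∈ Finset.range (N + 1), (1 / ((N : ℝ) + 1)) • (A ^ k).mulVec x₀
    have haP : ∀ N, a N ∈ P := by
      intro N
      refine hconv.sum_mem (fun _ _ => by positivity) ?_ (fun k _ => hx k)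
      have : (N : ℝ) + 1 ≠ 0 := by positivity
      simp [this]
    have hdiff : ∀ N, A.mulVec (a N) - a N
        = (1 / ((N : ℝ) + 1)) • ((A ^ (N + 1)).mulVec x₀ - x₀) := by
      intro N
      simp only [a]
      rw [← Finset.smul_sum, Matrix.mulVec_smul, ← smul_sub]
      congr 1
      rw [Matrix.mulVec_sum, ← Finset.sum_sub_distrib]
      have := Finset.sum_range_sub (fun k => (A ^ k).mulVec x₀) (N + 1)
      simp only [pow_zero, Matrix.one_mulVec] at this
      rw [← this]
      refine Finset.sum_congr rfl fun k _ => ?_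
      rw [Matrix.mulVec_mulVec, ← pow_succ']
    obtain ⟨C, hC⟩ := hcompact.isBounded.exists_norm_le
    have h0 : Filter.Tendsto (fun N => A.mulVec (a N) - a N) Filter.atTop (nhds 0) := by
      have hlim := (tendsto_one_div_add_atTop_nhds_zero_nat (𝕜 := ℝ)).mul_const (C + C)
      rw [zero_mul] at hlim
      refine squeeze_zero_norm (fun N => ?_) hlim
      rw [hdiff, norm_smul, Real.norm_of_nonneg (by positivity)]
      refine mul_le_mul_of_nonneg_left ?_ (by positivity)
      have h1 := hC _ (hx 0)
      rw [pow_zero, Matrix.one_mulVec] at h1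
      exact (norm_sub_le _ _).trans (add_le_add (hC _ (hx (N + 1))) h1)
    obtain ⟨y, hy, φ, hφ, hlim⟩ := hcompact.tendsto_subseq haP
    refine ⟨y, hy, ?_⟩
    have hcont : Continuous fun x : Fin d → ℝ => A.mulVec x - x := by fun_prop
    have h1 := (hcont.tendsto y).comp hlim
    have h2 := h0.comp hφ.tendsto_atTop
    exact sub_eq_zero.mp (tendsto_nhds_unique h1 h2)
  · rintro ⟨y, hy, hA⟩
    refine ⟨y, hy, fun m => ?_⟩
    have : (A ^ m).mulVec y = y := by
      induction m with
      | zero => simp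
      | succ k ih => rw [pow_succ, ← Matrix.mulVec_mulVec, hA, ih]
    rwa [this]
end

section
/- Call a d×d real matrix J a Jordan matrix if J is upper bidiagonal (J_{ij} = 0 unless j = i or j = i+1), each superdiagonal entry J_{i,i+1} lies in {0,1}, and J_{i,i+1} = 1 implies J_{ii} = J_{i+1,i+1}. Let d ≥ 1, b ≥ 1, let A be a d×d matrix, B an n×d matrix, and c ∈ ℚⁿ, all with rational entries of bit size at most b. Suppose all complex eigenvalues of A are real, and the polytope P = {x ∈ ℝᵈ : Bx ≤ c componentwise} is compact and contains no point y with Ay = 0. Then there exist an invertible real d×d matrix Q with Q A Q⁻¹ = J a Jordan matrix, and real numbers C ≥ ε > 0 with C/ε ≤ exp(640·b·d^{3d+8}), such that: (1) Q·x ∈ [-C,C]ᵈ for every x ∈ P; and (2) for every y ∈ ℝᵈ with Jy = 0, the hypercube {y + z : z ∈ [-ε,ε]ᵈ} is disjoint from the image Q·P = {Qx : x ∈ P}. -/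
/-- A rational number has bit size at most `b` if its numerator and denominator
are bounded by `2^b`. -/
def RatBitSizeLE (q : ℚ) (b : ℕ) : Prop :=
  |q.num| ≤ 2 ^ b ∧ q.den ≤ 2 ^ b

/-- A real `d×d` matrix is a Jordan matrix if it is upper bidiagonal, its
superdiagonal entries lie in `{0,1}`, and a superdiagonal `1` forces the two
adjacent diagonal entries to agree. -/
def IsJordanMatrix {d : ℕ} (J : Matrix (Fin d) (Fin d) ℝ) : Prop :=
  (∀ i j : Fin d, (j : ℕ) ≠ (i : ℕ) → (j : ℕ) ≠ (i : ℕ) + 1 → J i j = 0) ∧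
  (∀ i j : Fin d, (j : ℕ) = (i : ℕ) + 1 → J i j = 0 ∨ J i j = 1) ∧
  (∀ i j : Fin d, (j : ℕ) = (i : ℕ) + 1 → J i j = 1 → J i i = J j j)


open Polynomial in
theorem jhb_aeval_restrict {K V : Type*} [Field K] [AddCommGroup V] [Module K V]
    (f : Module.End K V) (W : Submodule K V) (h : ∀ x ∈ W, f x ∈ W) (p : K[X]) :
    ∀ x : W, ((aeval (f.restrict h) p x : W) : V) = aeval f p (x : V) := by
  induction p using Polynomial.induction_on with
  | C a => intro x; simp [Module.algebraMap_end_apply]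
  | add p q hp hq => intro x; simp [hp, hq]
  | monomial n a ih =>
    intro x
    have e1 : (C a * X ^ (n + 1) : K[X]) = (C a * X ^ n) * X := by ring
    rw [e1, map_mul _ (C a * X ^ n) X, map_mul _ (C a * X ^ n) X, Module.End.mul_apply,
      Module.End.mul_apply, ih]
    simp

open Polynomial in
theorem jhb_jordan_aux {K : Type*} [Field K] (n : ℕ) :
    ∀ (V : Type*) [AddCommGroup V] [Module K V] [FiniteDimensional K V] (f : Module.End K V),
      Module.finrank K V = n → (minpoly K f).Splits →
      ∃ (v : ℕ → V) (lam eps : ℕ → K), eps 0 = 0 ∧ (∀ i, eps i = 0 ∨ eps i = 1) ∧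
        (∀ i, eps (i + 1) = 1 → lam i = lam (i + 1)) ∧
        (∀ i < n, (minpoly K f).IsRoot (lam i)) ∧
        (∀ i < n, f (v i) = lam i • v i + eps i • v (i - 1)) ∧
        (∀ x : V, ∃ a : ℕ → K, x = ∑ i ∈ Finset.range n, a i • v i) := by
  induction n using Nat.strong_induction_on with
  | _ n ih =>
  intro V _ _ _ f hn hsp
  rcases Nat.eq_zero_or_pos n with h0 | hpos
  · subst h0
    have : Subsingleton V := Module.finrank_zero_iff.mp hn
    refine ⟨fun _ => 0, fun _ => 0, fun _ => 0, rfl, fun _ => Or.inl rfl, ?_, ?_, ?_, ?_⟩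
    · intro i h; rfl
    · intro i h; omega
    · intro i h; omega
    · intro x; exact ⟨fun _ => 0, Subsingleton.elim _ _⟩
  have : Nontrivial V := Module.nontrivial_of_finrank_pos (R := K) (by omega)
  have hIntegral : IsIntegral K f := Algebra.IsIntegral.isIntegral f
  have hmne : minpoly K f ≠ 0 := minpoly.ne_zero hIntegral
  obtain ⟨lam0, hlam0⟩ := hsp.exists_eval_eq_zero (minpoly.degree_pos hIntegral).ne'
  obtain ⟨q, hq, hqn⟩ := exists_eq_pow_rootMultiplicity_mul_and_not_dvd _ hmne lam0
  have hepos : 0 < (minpoly K f).rootMultiplicity lam0 :=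
    (rootMultiplicity_pos hmne).mpr hlam0
  generalize (minpoly K f).rootMultiplicity lam0 = e at hq hepos
  obtain ⟨e, rfl⟩ : ∃ e', e = e' + 1 := ⟨e - 1, by omega⟩
  set g : Module.End K V := f - algebraMap K _ lam0 with hg
  have hgX : aeval f (X - C lam0) = g := by simp [hg]
  set r : Module.End K V := aeval f q with hr
  have hfac : g ^ (e + 1) * r = 0 := by
    have := minpoly.aeval K f
    rw [hq] at this
    simpa [hgX] using this
  have hcomm : Commute g r := by
    rw [← hgX, hr]; exact Commute.all (X - C lam0) q |>.map (aeval f)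
  have hne : r * g ^ e * r ≠ 0 := by
    intro h
    have h1 : aeval f (q * (X - C lam0) ^ e * q) = 0 := by
      simpa [map_mul, map_pow, hgX] using h
    have h2 := minpoly.dvd K f h1
    rw [hq] at h2
    have h3 : (X - C lam0) * (((X - C lam0) ^ e) * q) ∣ (q * (((X - C lam0) ^ e) * q)) := by
      convert h2 using 1 <;> ring
    have hne0 : ((X - C lam0) ^ e) * q ≠ 0 := by
      intro h; apply hmne; rw [hq, pow_succ', mul_assoc, h, mul_zero]
    exact hqn ((mul_dvd_mul_iff_right hne0).mp h3)
  obtain ⟨u, hu⟩ : ∃ u, (r * g ^ e * r) u ≠ 0 := by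
    by_contra h; push Not at h; exact hne (LinearMap.ext h)
  obtain ⟨psi, hpsi⟩ := Module.Projective.exists_dual_eq_one K hu
  set w : V := r u with hwdef
  set phi : V →ₗ[K] K := psi ∘ₗ r with hphi
  have hw : ∀ k, e + 1 ≤ k → (g ^ k) w = 0 := by
    intro k hk
    obtain ⟨m, rfl⟩ := Nat.exists_eq_add_of_le hk
    have : g ^ (e + 1 + m) * r = 0 := by
      rw [add_comm, pow_add, mul_assoc, hfac, mul_zero]
    rw [hwdef, ← Module.End.mul_apply, this]; rfl
  have hph : ∀ k, e + 1 ≤ k → ∀ x, phi ((g ^ k) x) = 0 := by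
    intro k hk x
    obtain ⟨m, rfl⟩ := Nat.exists_eq_add_of_le hk
    have : r * g ^ (e + 1 + m) = 0 := by
      rw [pow_add, ← mul_assoc, ← (hcomm.pow_left (e + 1)).eq, hfac, zero_mul]
    have h2 : r ((g ^ (e + 1 + m)) x) = 0 := by
      rw [← Module.End.mul_apply, this]; rfl
    simp [hphi, h2]
  have hone : phi ((g ^ e) w) = 1 := by
    simpa [hphi, hwdef, Module.End.mul_apply] using hpsi
  let Psi : (Fin (e + 1) → K) →ₗ[K] V :=
    ∑ j : Fin (e + 1), (LinearMap.proj j : (Fin (e + 1) → K) →ₗ[K] K).smulRight ((g ^ (j : ℕ)) w)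
  have hPsi : ∀ a, Psi a = ∑ j : Fin (e + 1), a j • (g ^ (j : ℕ)) w := by
    intro a; simp [Psi]
  let Phi : V →ₗ[K] (Fin (e + 1) → K) := LinearMap.pi fun i => phi ∘ₗ (g ^ (i : ℕ))
  have hPhi : ∀ x i, Phi x i = phi ((g ^ (i : ℕ)) x) := by
    intro x i; simp [Phi]
  have hinj : Function.Injective (Phi ∘ₗ Psi) := by
    rw [← LinearMap.ker_eq_bot, LinearMap.ker_eq_bot']
    intro a ha
    have key : ∀ m (hm : m < e + 1), a ⟨m, hm⟩ = 0 := by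
      intro m
      induction m using Nat.strong_induction_on with
      | _ m ihm =>
      intro hm
      have h1 := congrFun ha ⟨e - m, by omega⟩
      rw [LinearMap.comp_apply, hPhi, hPsi] at h1
      simp only [map_sum, map_smul, Pi.zero_apply] at h1
      rw [Finset.sum_eq_single (⟨m, hm⟩ : Fin (e + 1))] at h1
      · rw [← Module.End.mul_apply, ← pow_add] at h1
        have : e - m + m = e := by omega
        simpa [this, hone] using h1
      · intro j _ hj
        have hj' : (j : ℕ) ≠ m := fun h => hj (Fin.ext h)
        rcases lt_or_gt_of_ne hj' with h | h
        · rw [ihm j h j.2, zero_smul]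
        · rw [← Module.End.mul_apply, ← pow_add, hw _ (by omega)]; simp
      · intro h; exact absurd (Finset.mem_univ _) h
    ext i; exact key i i.2
  have hsurj : Function.Surjective (Phi ∘ₗ Psi) := LinearMap.injective_iff_surjective.mp hinj
  have hPhisurj : Function.Surjective Phi := fun y => by
    obtain ⟨a, ha⟩ := hsurj y; exact ⟨Psi a, ha⟩
  set W := LinearMap.ker Phi with hW
  have hdim : (e + 1) + Module.finrank K W = n := by
    have := LinearMap.finrank_range_add_finrank_ker Phi
    rw [LinearMap.range_eq_top.mpr hPhisurj, finrank_top, Module.finrank_fin_fun, hn] at this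
    exact this
  have hfg : ∀ x, f x = g x + lam0 • x := by intro x; simp [hg, Module.algebraMap_end_apply]
  have hWf : ∀ x ∈ W, f x ∈ W := by
    intro x hx
    have hx' : ∀ i, i < e + 1 → phi ((g ^ i) x) = 0 := by
      intro i hi
      have := congrFun (LinearMap.mem_ker.mp hx) ⟨i, hi⟩
      rwa [hPhi] at this
    rw [hW, LinearMap.mem_ker]
    ext i
    rw [hPhi, hfg, map_add, map_add, map_smul, map_smul, hx' i i.2, ← Module.End.mul_apply,
      ← pow_succ]
    rcases Nat.lt_or_ge ((i : ℕ) + 1) (e + 1) with h | h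
    · simp [hx' _ h]
    · simp [hph _ h]
  have hdvd : minpoly K (f.restrict hWf) ∣ minpoly K f := by
    apply minpoly.dvd
    ext x
    rw [jhb_aeval_restrict, minpoly.aeval]; rfl
  obtain ⟨v', lam', eps', h0', h01', hch', hroot', hf', hspan'⟩ :=
    ih (Module.finrank K W) (by omega) W (f.restrict hWf) rfl (hsp.of_dvd hmne hdvd)
  refine ⟨fun i => if i < e + 1 then (g ^ (e - i)) w else (v' (i - (e + 1)) : V),
    fun i => if i < e + 1 then lam0 else lam' (i - (e + 1)),
    fun i => if i < e + 1 then (if i = 0 then 0 else 1) else eps' (i - (e + 1)), ?_, ?_, ?_, ?_, ?_, ?_⟩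
  · simp
  · intro i
    dsimp only
    split_ifs
    · left; rfl
    · right; rfl
    · exact h01' _
  · intro i
    dsimp only
    intro h
    by_cases h1 : i + 1 < e + 1
    · rw [if_pos h1, if_pos (by omega)]
    · rw [if_neg h1] at h
      by_cases h2 : i < e + 1
      · have : i + 1 - (e + 1) = 0 := by omega
        rw [this, h0'] at h
        exact absurd h zero_ne_one
      · rw [if_neg h1, if_neg h2]
        have : i + 1 - (e + 1) = (i - (e + 1)) + 1 := by omega
        rw [this] at h ⊢
        exact hch' _ h
  · intro i hi
    dsimp only
    split_ifs with h
    · exact hlam0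
    · exact (hroot' _ (by omega)).dvd hdvd
  · intro i hi
    dsimp only
    by_cases h : i < e + 1
    · rw [if_pos h, if_pos h, if_pos h, if_pos (by omega : i - 1 < e + 1), hfg,
        ← Module.End.mul_apply, ← pow_succ', add_comm]
      congr 1
      by_cases h2 : i = 0
      · rw [if_pos h2, zero_smul]; exact hw _ (by omega)
      · rw [if_neg h2, one_smul]; congr 2; omega
    · rw [if_neg h, if_neg h, if_neg h]
      have h3 := congrArg (Subtype.val) (hf' (i - (e + 1)) (by omega))
      simp only [LinearMap.coe_restrict_apply, Submodule.coe_add, Submodule.coe_smul] at h3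
      rw [h3]
      congr 1
      by_cases h4 : i - 1 < e + 1
      · have : i - (e + 1) = 0 := by omega
        rw [this, h0', zero_smul, zero_smul]
      · rw [if_neg h4]; congr 3; omega
  · intro x
    obtain ⟨a, ha⟩ := hsurj (Phi x)
    have hx : x - Psi a ∈ W := by
      rw [hW, LinearMap.mem_ker, map_sub, sub_eq_zero]; exact ha.symm
    obtain ⟨a', ha'⟩ := hspan' ⟨x - Psi a, hx⟩
    have ha2 := congrArg Subtype.val ha'
    simp only [Submodule.coe_sum, Submodule.coe_smul] at ha2
    refine ⟨fun i => if h : i < e + 1 then a ⟨e - i, by omega⟩ else a' (i - (e + 1)), ?_⟩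
    rw [← hdim, Finset.sum_range_add]
    have e1 : ∑ i ∈ Finset.range (Module.finrank K W),
        (fun i => (if h : i < e + 1 then a ⟨e - i, by omega⟩ else a' (i - (e + 1))) •
          (if i < e + 1 then (g ^ (e - i)) w else (v' (i - (e + 1)) : V))) (e + 1 + i)
        = x - Psi a := by
      rw [ha2]
      apply Finset.sum_congr rfl
      intro i _
      have h1 : ¬ (e + 1 + i < e + 1) := by omega
      have h2 : e + 1 + i - (e + 1) = i := by omega
      simp only [dif_neg h1, if_neg h1, h2]
    have e2 : ∑ i ∈ Finset.range (e + 1),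
        (fun i => (if h : i < e + 1 then a ⟨e - i, by omega⟩ else a' (i - (e + 1))) •
          (if i < e + 1 then (g ^ (e - i)) w else (v' (i - (e + 1)) : V))) i = Psi a := by
      rw [hPsi, Finset.sum_range, ← Equiv.sum_comp Fin.revPerm]
      apply Finset.sum_congr rfl
      intro i _
      have h3 : e - (e - (i : ℕ)) = i := by omega
      simp [Fin.rev, h3]
    rw [e2, e1]; abel


theorem jhb_row_sel {K ι κ : Type*} [Field K] [Fintype κ] [DecidableEq κ] (M : Matrix ι κ K) :
    ∃ (W : Matrix κ κ K) (F : Set κ), W.det ≠ 0 ∧ (∀ k ∈ F, ∃ i, W k = M i) ∧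
      (∀ k, k ∉ F → ∃ j, W k = Pi.single j 1) ∧
      (∀ x : κ → K, (∀ k ∈ F, W.mulVec x k = 0) → M.mulVec x = 0) := by
  obtain ⟨b, hb, hspan, hli⟩ := exists_linearIndependent K (Set.range fun i => M i)
  have hli' : LinearIndepOn K id b := hli
  set t : Set (κ → K) := b ∪ Set.range (fun j => (Pi.single j 1 : κ → K)) with ht
  have hbt : b ⊆ t := Set.subset_union_left
  have h1 := hli'.linearIndepOn_extend hbt
  have h2 := hli'.extend_subset hbt
  have h3 := hli'.subset_span_extend hbt
  set E := hli'.extend hbt with hE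
  have htop : ⊤ ≤ Submodule.span K (Set.range (Subtype.val : E → κ → K)) := by
    rw [Subtype.range_coe, ← (Pi.basisFun K κ).span_eq, Submodule.span_le]
    rintro _ ⟨j, rfl⟩
    apply h3
    right
    exact ⟨j, by simp⟩
  let B : Module.Basis E K (κ → K) := Module.Basis.mk (v := Subtype.val) h1 htop
  let e : E ≃ κ := B.indexEquiv (Pi.basisFun K κ)
  refine ⟨fun k => (e.symm k : κ → K), {k | (e.symm k : κ → K) ∈ b}, ?_, ?_, ?_, ?_⟩
  · have : LinearIndependent K (fun k => (e.symm k : κ → K)) :=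
      LinearIndependent.comp (ι := E) h1 e.symm e.symm.injective
    have := Matrix.linearIndependent_rows_iff_isUnit.mp this
    exact ((Matrix.isUnit_iff_isUnit_det _).mp this).ne_zero
  · intro k hk
    obtain ⟨i, hi⟩ := hb hk
    exact ⟨i, hi.symm⟩
  · intro k hk
    rcases h2 (e.symm k).2 with h | ⟨j, hj⟩
    · exact absurd h hk
    · exact ⟨j, hj.symm⟩
  · intro x hx
    have hb0 : ∀ v ∈ Submodule.span K b, v ⬝ᵥ x = 0 := by
      intro v hv
      induction hv using Submodule.span_induction with
      | mem v hv =>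
        have hvE : v ∈ E := hli'.subset_extend hbt hv
        have := hx (e ⟨v, hvE⟩) (by simpa using hv)
        simpa [Matrix.mulVec] using this
      | zero => simp
      | add u v _ _ hu hv => rw [add_dotProduct, hu, hv, add_zero]
      | smul a v _ hv => rw [smul_dotProduct, hv, smul_zero]
    ext i
    apply hb0
    rw [hspan]
    exact Submodule.subset_span ⟨i, rfl⟩

open Polynomial in
theorem jhb_det_poly {K : Type*} [Field K] [CharZero K] {n κ : Type*} [Fintype n] [DecidableEq n]
    [DecidableEq κ]
    (L : (κ → K) →ₗ[K] Matrix n n K) (s : κ → K) (T : Finset κ) (hs : (L s).det ≠ 0) :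
    ∃ s' : κ → K, (L s').det ≠ 0 ∧ (∀ k, k ∉ T → s' k = s k) ∧
      (∀ k ∈ T, ∃ m : ℕ, m ≤ Fintype.card n ∧ s' k = m) := by
  induction T using Finset.induction_on with
  | empty => exact ⟨s, hs, fun _ _ => rfl, by simp⟩
  | insert k T hk ih =>
    obtain ⟨s', h1, h2, h3⟩ := ih
    set X1 := L (Pi.single k 1) with hX1
    set X0 := L (Function.update s' k 0) with hX0
    have hup : ∀ u, L (Function.update s' k u) = u • X1 + X0 := by
      intro u
      rw [hX1, hX0, ← map_smul, ← map_add]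
      congr 1
      ext j
      by_cases hj : j = k
      · subst hj; simp
      · simp [hj]
    set p : K[X] := ((X : K[X]) • X1.map C + X0.map C).det with hp
    have hev : ∀ u, p.eval u = (L (Function.update s' k u)).det := by
      intro u
      rw [hp, hup, ← coe_evalRingHom, RingHom.map_det]
      congr 1
      ext i j
      simp
      ring
    have hpne : p ≠ 0 := by
      intro h
      apply h1
      have := hev (s' k)
      rw [h, Function.update_eq_self] at this
      simpa using this.symm
    have hdeg : p.natDegree ≤ Fintype.card n := natDegree_det_X_add_C_le _ _
    obtain ⟨m, hm, hm2⟩ : ∃ m : ℕ, m ≤ Fintype.card n ∧ p.eval (m : K) ≠ 0 := by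
      classical
      by_contra hcon
      push Not at hcon
      apply hpne
      apply Polynomial.eq_zero_of_natDegree_lt_card_of_eval_eq_zero' p
        ((Finset.range (Fintype.card n + 1)).image (Nat.cast : ℕ → K))
      · intro x hx
        obtain ⟨m, hm, rfl⟩ := Finset.mem_image.mp hx
        exact hcon m (by simpa [Nat.lt_succ_iff] using hm)
      · rw [Finset.card_image_of_injective _ Nat.cast_injective, Finset.card_range]
        omega
    refine ⟨Function.update s' k m, by rw [← hev]; exact hm2, ?_, ?_⟩
    · intro j hj
      rw [Finset.mem_insert, not_or] at hj
      rw [Function.update_of_ne hj.1, h2 j hj.2]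
    · intro j hj
      by_cases hjk : j = k
      · subst hjk; exact ⟨m, hm, by simp⟩
      · rw [Function.update_of_ne hjk]
        exact h3 j (Finset.mem_of_mem_insert_of_ne hj hjk)

theorem jhb_kernel {K : Type*} [Field K] [CharZero K] {d : ℕ}
    (M : Matrix (Fin d × Fin d) (Fin d × Fin d) K) (X0 : Matrix (Fin d) (Fin d) K)
    (hdet : X0.det ≠ 0) (hM : M.mulVec (fun p => X0 p.1 p.2) = 0) :
    ∃ (W : Matrix (Fin d × Fin d) (Fin d × Fin d) K) (s : Fin d × Fin d → ℕ)
      (X : Matrix (Fin d) (Fin d) K),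
      (∀ k, (∃ i, W k = M i) ∨ (∃ j, W k = Pi.single j 1)) ∧ (∀ k, s k ≤ d) ∧
      (∀ i j, X i j = W.adjugate.mulVec (fun k => (s k : K)) (i, j)) ∧ X.det ≠ 0 ∧
      M.mulVec (fun p => X p.1 p.2) = 0 := by
  classical
  obtain ⟨W, F, hW, hF1, hF2, hF3⟩ := jhb_row_sel M
  let L : (Fin d × Fin d → K) →ₗ[K] Matrix (Fin d) (Fin d) K :=
    { toFun := fun s => Matrix.of fun i j => W.adjugate.mulVec s (i, j)
      map_add' := by intro x y; ext i j; simp [Matrix.mulVec_add]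
      map_smul' := by intro x y; ext i j; simp [Matrix.mulVec_smul] }
  have hL : ∀ s i j, L s i j = W.adjugate.mulVec s (i, j) := fun _ _ _ => rfl
  set s0 := W.mulVec (fun p => X0 p.1 p.2) with hs0
  have hLs0 : L s0 = W.det • X0 := by
    ext i j
    rw [hL, hs0, Matrix.mulVec_mulVec, Matrix.adjugate_mul, Matrix.smul_mulVec, Matrix.one_mulVec]
    rfl
  have hne : (L s0).det ≠ 0 := by
    rw [hLs0, Matrix.det_smul]
    exact mul_ne_zero (pow_ne_zero _ hW) hdet
  have hs0F : ∀ k ∈ F, s0 k = 0 := by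
    intro k hk
    obtain ⟨i, hi⟩ := hF1 k hk
    have := congrFun hM i
    rw [hs0]
    simp only [Matrix.mulVec] at this ⊢
    rw [hi]; exact this
  obtain ⟨s', h1, h2, h3⟩ := jhb_det_poly L s0 (Finset.univ.filter (fun k => k ∉ F)) hne
  have hnat : ∀ k, ∃ m : ℕ, m ≤ d ∧ s' k = m := by
    intro k
    by_cases hk : k ∈ F
    · exact ⟨0, Nat.zero_le _, by rw [h2 k (by simpa using hk), hs0F k hk]; simp⟩
    · simpa using h3 k (by simpa using hk)
  choose s hs1 hs2 using hnat
  have hss : (fun k => (s k : K)) = s' := by ext k; rw [hs2]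
  refine ⟨W, s, L s', ?_, hs1, ?_, h1, ?_⟩
  · intro k
    by_cases hk : k ∈ F
    · exact Or.inl (hF1 k hk)
    · exact Or.inr (hF2 k hk)
  · intro i j; rw [hss]; rfl
  · apply hF3
    intro k hk
    have : (fun p : Fin d × Fin d => L s' p.1 p.2) = W.adjugate.mulVec s' := by
      ext p; rfl
    rw [this, Matrix.mulVec_mulVec, Matrix.mul_adjugate, Matrix.smul_mulVec, Matrix.one_mulVec]
    rw [Pi.smul_apply, h2 k (by simpa using hk), hs0F k hk, smul_zero]

theorem jhb_jordan_matrix {K : Type*} [Field K] {d : ℕ} (A : Matrix (Fin d) (Fin d) K)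
    (h : A.charpoly.Splits) :
    ∃ V J : Matrix (Fin d) (Fin d) K, V.det ≠ 0 ∧ A * V = V * J ∧
      (∀ i j : Fin d, (j : ℕ) ≠ (i : ℕ) → (j : ℕ) ≠ (i : ℕ) + 1 → J i j = 0) ∧
      (∀ i j : Fin d, (j : ℕ) = (i : ℕ) + 1 → J i j = 0 ∨ J i j = 1) ∧
      (∀ i j : Fin d, (j : ℕ) = (i : ℕ) + 1 → J i j = 1 → J i i = J j j) ∧
      (∀ i, A.charpoly.IsRoot (J i i)) := by
  have hdvd := A.minpoly_dvd_charpoly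
  rw [← Matrix.minpoly_toLin'] at hdvd
  obtain ⟨v, lam, eps, h0, h01, hch, hroot, hf, hspan⟩ :=
    jhb_jordan_aux d (Fin d → K) (Matrix.toLin' A) (by simp)
      (h.of_dvd A.charpoly_monic.ne_zero hdvd)
  let J : Matrix (Fin d) (Fin d) K := fun i j =>
    if (j : ℕ) = i then lam j else if (j : ℕ) = i + 1 then eps j else 0
  refine ⟨Matrix.of fun i j => v j i, J, ?_, ?_, ?_, ?_, ?_, ?_⟩
  · have hcol : ⊤ ≤ Submodule.span K (Set.range (fun j : Fin d => v j)) := by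
      intro x _
      obtain ⟨a, ha⟩ := hspan x
      rw [ha]
      apply Submodule.sum_mem
      intro i hi
      apply Submodule.smul_mem
      exact Submodule.subset_span ⟨⟨i, Finset.mem_range.mp hi⟩, rfl⟩
    have hli := linearIndependent_of_top_le_span_of_card_eq_finrank hcol (by simp)
    have : IsUnit (Matrix.of fun i j : Fin d => v j i) :=
      Matrix.linearIndependent_cols_iff_isUnit.mp hli
    exact ((Matrix.isUnit_iff_isUnit_det _).mp this).ne_zero
  · ext i j
    have h1 := congrFun (hf j j.2) i
    rw [Matrix.toLin'_apply] at h1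
    have h2 : (A * (Matrix.of fun i j => v j i : Matrix (Fin d) (Fin d) K)) i j = A.mulVec (v j) i := rfl
    rw [h2, h1, Matrix.mul_apply]
    simp only [Pi.add_apply, Pi.smul_apply, smul_eq_mul]
    rcases Nat.eq_zero_or_pos (j : ℕ) with hj | hj
    · rw [Finset.sum_eq_single j]
      · simp [J, hj, h0, mul_comm]
      · intro k _ hk
        have hk' : (k : ℕ) ≠ j := fun h => hk (Fin.ext h)
        simp only [J]
        rw [if_neg (by omega), if_neg (by omega), mul_zero]
      · simp
    · let j' : Fin d := ⟨j - 1, by omega⟩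
      have hjj : j ≠ j' := by intro h; have := congrArg Fin.val h; simp [j'] at this; omega
      rw [← Finset.sum_subset (Finset.subset_univ {j, j'}), Finset.sum_pair hjj]
      · have e1 : J j j = lam j := by simp [J]
        have e2 : J j' j = eps j := by
          simp only [J, j']
          rw [if_neg (by omega), if_pos (by omega)]
        rw [e1, e2, mul_comm, mul_comm (eps j)]
        rfl
      · intro k _ hk
        simp only [Finset.mem_insert, Finset.mem_singleton, not_or] at hk
        have hk1 : (k : ℕ) ≠ j := fun h => hk.1 (Fin.ext h)
        have hk2 : (k : ℕ) ≠ j - 1 := fun h => hk.2 (Fin.ext h)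
        simp only [J]
        rw [if_neg (by omega), if_neg (by omega), mul_zero]
  · intro i j h1 h2
    simp only [J]; rw [if_neg h1, if_neg h2]
  · intro i j h1
    simp only [J]; rw [if_neg (by omega), if_pos h1]; exact h01 _
  · intro i j h1
    have e1 : J i j = eps j := by simp only [J]; rw [if_neg (by omega), if_pos h1]
    have e2 : J i i = lam i := by simp [J]
    have e3 : J j j = lam j := by simp [J]
    rw [e1, e2, e3, h1]
    exact hch i
  · intro i
    have e2 : J i i = lam i := by simp [J]
    rw [e2]
    exact (hroot i i.2).dvd hdvd

/-- Integral elements all of whose conjugates are bounded by `M`. -/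
def JhbBd {K : Type*} [Field K] [Algebra ℚ K] (M : ℝ) (x : K) : Prop :=
  IsIntegral ℤ x ∧ ∀ σ : K →ₐ[ℚ] ℂ, ‖σ x‖ ≤ M

section JhbBd

variable {K : Type*} [Field K] [Algebra ℚ K]

theorem JhbBd.mono {M M' : ℝ} {x : K} (h : JhbBd M x) (hM : M ≤ M') : JhbBd M' x :=
  ⟨h.1, fun σ => (h.2 σ).trans hM⟩

theorem JhbBd.add {M M' : ℝ} {x y : K} (h : JhbBd M x) (h' : JhbBd M' y) :
    JhbBd (M + M') (x + y) :=
  ⟨h.1.add h'.1, fun σ => by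
    rw [map_add]; exact (norm_add_le _ _).trans (add_le_add (h.2 σ) (h'.2 σ))⟩

theorem JhbBd.sub {M M' : ℝ} {x y : K} (h : JhbBd M x) (h' : JhbBd M' y) :
    JhbBd (M + M') (x - y) :=
  ⟨h.1.sub h'.1, fun σ => by
    rw [map_sub]; exact (norm_sub_le _ _).trans (add_le_add (h.2 σ) (h'.2 σ))⟩

theorem JhbBd.mul {M M' : ℝ} {x y : K} (h : JhbBd M x) (h' : JhbBd M' y) (hM : 0 ≤ M) :
    JhbBd (M * M') (x * y) :=
  ⟨h.1.mul h'.1, fun σ => by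
    rw [map_mul, norm_mul]; exact mul_le_mul (h.2 σ) (h'.2 σ) (norm_nonneg _) hM⟩

theorem jhbBd_natCast (m : ℕ) : JhbBd (m : ℝ) (m : K) :=
  ⟨by simpa using (isIntegral_algebraMap (R := ℤ) (A := K) (x := (m : ℤ))), fun σ => by simp⟩

theorem jhbBd_intCast (m : ℤ) : JhbBd |(m : ℝ)| (m : K) :=
  ⟨by simpa using (isIntegral_algebraMap (R := ℤ) (A := K) (x := m)), fun σ => by simp⟩

theorem jhbBd_zero {M : ℝ} (hM : 0 ≤ M) : JhbBd M (0 : K) :=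
  (by simpa using jhbBd_natCast (K := K) 0 : JhbBd 0 (0 : K)).mono hM

theorem jhbBd_one {M : ℝ} (hM : 1 ≤ M) : JhbBd M (1 : K) :=
  (by simpa using jhbBd_natCast (K := K) 1 : JhbBd 1 (1 : K)).mono hM

theorem jhbBd_sum {ι : Type*} [Fintype ι] {M : ℝ} {x : ι → K} (h : ∀ i, JhbBd M (x i)) :
    JhbBd (Fintype.card ι * M) (∑ i, x i) := by
  refine ⟨IsIntegral.sum _ fun i _ => (h i).1, fun σ => ?_⟩
  rw [map_sum]
  refine (norm_sum_le _ _).trans ?_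
  refine (Finset.sum_le_card_nsmul _ _ M fun i _ => (h i).2 σ).trans ?_
  simp

theorem jhbBd_det {ι : Type*} [Fintype ι] [DecidableEq ι] {M : ℝ} {x : Matrix ι ι K}
    (h : ∀ i j, JhbBd M (x i j)) :
    JhbBd ((Fintype.card ι).factorial * M ^ (Fintype.card ι)) x.det := by
  refine ⟨IsIntegral.det fun i j => (h i j).1, fun σ => ?_⟩
  have h1 : σ x.det = (x.map σ).det := AlgHom.map_det σ x
  rw [h1]
  have := Matrix.det_le (A := x.map σ) (abv := NormedField.toAbsoluteValue ℂ) (x := M)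
    (fun i j => (h i j).2 σ)
  rw [nsmul_eq_mul] at this
  exact this

theorem jhbBd_adjugate {ι : Type*} [Fintype ι] [DecidableEq ι] {M : ℝ} (hM : 1 ≤ M)
    {x : Matrix ι ι K} (h : ∀ i j, JhbBd M (x i j)) (i j : ι) :
    JhbBd ((Fintype.card ι).factorial * M ^ (Fintype.card ι)) (x.adjugate i j) := by
  rw [Matrix.adjugate_apply]
  apply jhbBd_det
  intro k l
  by_cases hk : k = j
  · subst hk
    rw [Matrix.updateRow_self]
    by_cases hl : l = i
    · subst hl; simpa using jhbBd_one hM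
    · simpa [hl] using jhbBd_zero (by linarith)
  · rw [Matrix.updateRow_ne hk]; exact h k l

theorem jhbBd_lower [FiniteDimensional ℚ K] {M : ℝ} (hM : 1 ≤ M) {x : K} (hx : x ≠ 0)
    (h : JhbBd M x) {F : ℕ} (hF : Nat.card (K →ₐ[ℚ] ℂ) ≤ F) (σ₀ : K →ₐ[ℚ] ℂ) :
    1 ≤ ‖σ₀ x‖ * M ^ F := by
  classical
  have h1 := Algebra.norm_eq_prod_embeddings ℚ ℂ x
  have h2 : IsIntegral ℤ (Algebra.norm ℚ x) := Algebra.isIntegral_norm ℚ h.1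
  obtain ⟨z, hz⟩ := IsIntegrallyClosed.isIntegral_iff.mp h2
  have hz0 : z ≠ 0 := by
    rintro rfl
    rw [map_zero] at hz
    exact (Algebra.norm_ne_zero_iff.mpr hx) hz.symm
  have h3 : (1 : ℝ) ≤ ‖(algebraMap ℚ ℂ) (Algebra.norm ℚ x)‖ := by
    rw [← hz]
    have : (1 : ℤ) ≤ |z| := Int.one_le_abs hz0
    have h4 : (1 : ℝ) ≤ |(z : ℝ)| := by exact_mod_cast this
    simpa using h4
  rw [h1, norm_prod, ← Finset.mul_prod_erase _ _ (Finset.mem_univ σ₀)] at h3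
  refine h3.trans (mul_le_mul_of_nonneg_left ?_ (norm_nonneg _))
  calc ∏ σ ∈ Finset.univ.erase σ₀, ‖σ x‖ ≤ ∏ σ ∈ Finset.univ.erase σ₀, M :=
        Finset.prod_le_prod (fun _ _ => norm_nonneg _) fun σ _ => h.2 σ
    _ = M ^ (Finset.univ.erase σ₀).card := by rw [Finset.prod_const]
    _ ≤ M ^ F := by
        apply pow_le_pow_right₀ hM
        refine (Finset.card_le_univ _).trans ?_
        rwa [← Nat.card_eq_fintype_card]

end JhbBd

open Polynomial in
theorem jhb_card_emb (K : Type) [Field K] [Algebra ℚ K] (p : ℚ[X]) [IsSplittingField ℚ K p] {d : ℕ} (hd : 1 ≤ d) (hp : p.natDegree = d) :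
    Nat.card (K →ₐ[ℚ] ℂ) ≤ d ^ d := by
  classical
  let Φ : (K →ₐ[ℚ] ℂ) → (p.rootSet K → p.rootSet ℂ) :=
    fun σ x => ⟨σ x, rootSet_mapsTo σ x.2⟩
  have hinj : Function.Injective Φ := by
    intro σ τ h
    apply AlgHom.ext_of_adjoin_eq_top (IsSplittingField.adjoin_rootSet K p)
    intro x hx
    exact congrArg Subtype.val (congrFun h ⟨x, hx⟩)
  have hc : ∀ (L : Type) [Field L] [Algebra ℚ L], Nat.card (p.rootSet L) ≤ d := by
    intro L _ _
    rw [← hp]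
    exact p.ncard_rootSet_le L
  calc _ ≤ Nat.card (p.rootSet K → p.rootSet ℂ) := Nat.card_le_card_of_injective Φ hinj
    _ = Nat.card (p.rootSet ℂ) ^ Nat.card (p.rootSet K) := Nat.card_fun
    _ ≤ d ^ Nat.card (p.rootSet K) := Nat.pow_le_pow_left (hc ℂ) _
    _ ≤ d ^ d := Nat.pow_le_pow_right hd (hc _)

theorem jhb_eig_bound {d : ℕ} {M : Matrix (Fin d) (Fin d) ℂ} {a : ℝ}
    (ha : ∀ i j, ‖M i j‖ ≤ a) {μ : ℂ} (h : M.charpoly.IsRoot μ) : ‖μ‖ ≤ d * a := by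
  rw [Polynomial.IsRoot, Matrix.eval_charpoly] at h
  obtain ⟨v, hv0, hv⟩ := Matrix.exists_mulVec_eq_zero_iff.mpr h
  have hv' : ∀ i, μ * v i = ∑ j, M i j * v j := by
    intro i
    have := congrFun hv i
    rw [Matrix.sub_mulVec, Pi.sub_apply, Pi.zero_apply, sub_eq_zero] at this
    simpa [Matrix.mulVec, dotProduct, Matrix.diagonal_apply] using this
  have hne : ∃ i, v i ≠ 0 := by
    by_contra hcon; push Not at hcon; exact hv0 (funext hcon)
  obtain ⟨i0, hi0⟩ := hne
  obtain ⟨i, -, hi⟩ := Finset.exists_max_image Finset.univ (fun i => ‖v i‖) ⟨i0, Finset.mem_univ _⟩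
  have hpos : 0 < ‖v i‖ := (norm_pos_iff.mpr hi0).trans_le (hi i0 (Finset.mem_univ _))
  have h1 : ‖μ‖ * ‖v i‖ ≤ (d * a) * ‖v i‖ := by
    rw [← norm_mul, hv' i]
    refine (norm_sum_le _ _).trans ?_
    refine (Finset.sum_le_card_nsmul _ _ (a * ‖v i‖) fun j _ => ?_).trans ?_
    · rw [norm_mul]
      exact mul_le_mul (ha i j) (hi j (Finset.mem_univ _)) (norm_nonneg _)
        ((norm_nonneg _).trans (ha i j))
    · simp [mul_assoc]
  exact le_of_mul_le_mul_right h1 hpos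

theorem jhb_rat_abs {q : ℚ} {b : ℕ} (h : RatBitSizeLE q b) : |(q : ℝ)| ≤ 2 ^ b := by
  have h1 : (|q.num| : ℝ) ≤ 2 ^ b := by exact_mod_cast h.1
  have h2 : (1 : ℝ) ≤ q.den := by exact_mod_cast q.den_pos
  rw [Rat.cast_def, abs_div, Nat.abs_cast]
  exact (div_le_self (abs_nonneg _) h2).trans h1

theorem jhb_common_den {ι : Type*} [Fintype ι] {b : ℕ} (A : ι → ι → ℚ)
    (hA : ∀ i j, RatBitSizeLE (A i j) b) :
    ∃ (D : ℕ) (N : ι → ι → ℤ), 1 ≤ D ∧ D ≤ 2 ^ (b * (Fintype.card ι * Fintype.card ι)) ∧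
      ∀ i j, (N i j : ℚ) = D * A i j := by
  classical
  let D : ℕ := ∏ p : ι × ι, (A p.1 p.2).den
  have hdvd : ∀ i j, (A i j).den ∣ D := fun i j =>
    Finset.dvd_prod_of_mem (fun p : ι × ι => (A p.1 p.2).den) (Finset.mem_univ (i, j))
  choose m hm using hdvd
  refine ⟨D, fun i j => m i j * (A i j).num, ?_, ?_, ?_⟩
  · exact Finset.prod_pos fun (p : ι × ι) _ => (A p.1 p.2).den_pos
  · calc D ≤ ∏ _p : ι × ι, 2 ^ b := Finset.prod_le_prod' fun (p : ι × ι) _ => (hA p.1 p.2).2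
      _ = _ := by rw [Finset.prod_const, ← pow_mul, Finset.card_univ, Fintype.card_prod]
  · intro i j
    rw [hm i j]
    push_cast
    have h2 : ((A i j).den : ℚ) * A i j = (A i j).num := Rat.den_mul_eq_num (A i j)
    rw [← h2]; ring

theorem jhb_Dlam {K : Type*} [Field K] [Algebra ℚ K] {d b : ℕ} (A : Matrix (Fin d) (Fin d) ℚ)
    (hA : ∀ i j, RatBitSizeLE (A i j) b) (D : ℕ) (N : Fin d → Fin d → ℤ)
    (hN : ∀ i j, (N i j : ℚ) = D * A i j) {lam : K}
    (h : (A.map (algebraMap ℚ K)).charpoly.IsRoot lam) :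
    JhbBd (D * (d * 2 ^ b) : ℝ) ((D : K) * lam) := by
  constructor
  · have h0 := h
    rw [Polynomial.IsRoot, Matrix.eval_charpoly] at h0
    have h1 : (((Matrix.of N).map (Int.castRingHom K)).charpoly).eval ((D : K) * lam) = 0 := by
      rw [Matrix.eval_charpoly]
      have : Matrix.scalar (Fin d) ((D : K) * lam) - (Matrix.of N).map (Int.castRingHom K)
          = (D : K) • (Matrix.scalar (Fin d) lam - A.map (algebraMap ℚ K)) := by
        ext i j
        have h2 : ((N i j : ℤ) : K) = D * algebraMap ℚ K (A i j) := by
          have := congrArg (algebraMap ℚ K) (hN i j)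
          rwa [map_mul, map_intCast, map_natCast] at this
        simp [h2, mul_sub, Matrix.diagonal_apply]
      rw [this, Matrix.det_smul, h0, mul_zero]
    rw [Matrix.charpoly_map, Polynomial.eval_map] at h1
    exact ⟨(Matrix.of N).charpoly, Matrix.charpoly_monic _, h1⟩
  · intro σ
    have h1 : ((A.map (algebraMap ℚ K)).map σ).charpoly.IsRoot (σ lam) := by
      have := Polynomial.IsRoot.map (f := (σ : K →+* ℂ)) h
      rw [← Matrix.charpoly_map] at this
      exact this
    have h2 := jhb_eig_bound (a := 2 ^ b) (fun i j => by
      have := jhb_rat_abs (hA i j)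
      simpa using this) h1
    rw [map_mul, norm_mul]
    have : ‖σ (D : K)‖ = D := by simp
    rw [this]
    exact mul_le_mul_of_nonneg_left h2 (Nat.cast_nonneg _)

theorem jhb_alg_K {K : Type*} [Field K] [Algebra ℚ K] {d b : ℕ} (hd : 1 ≤ d) (hb : 1 ≤ b)
    (A : Matrix (Fin d) (Fin d) ℚ) (hA : ∀ i j, RatBitSizeLE (A i j) b)
    (hsp : (A.map (algebraMap ℚ K)).charpoly.Splits) :
    ∃ V J : Matrix (Fin d) (Fin d) K, V.det ≠ 0 ∧ A.map (algebraMap ℚ K) * V = V * J ∧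
      (∀ i j : Fin d, (j : ℕ) ≠ (i : ℕ) → (j : ℕ) ≠ (i : ℕ) + 1 → J i j = 0) ∧
      (∀ i j : Fin d, (j : ℕ) = (i : ℕ) + 1 → J i j = 0 ∨ J i j = 1) ∧
      (∀ i j : Fin d, (j : ℕ) = (i : ℕ) + 1 → J i j = 1 → J i i = J j j) ∧
      (∀ i j, JhbBd (2 ^ (8 * b * d ^ 4)) (V i j)) := by
  have : CharZero K := algebraRat.charZero K
  obtain ⟨V0, J, hV0, hAV, hJ1, hJ2, hJ3, hJ4⟩ := jhb_jordan_matrix _ hsp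
  obtain ⟨D, N, hD1, hD2, hN⟩ := jhb_common_den (fun i j => A i j) hA
  rw [Fintype.card_fin] at hD2
  have hDR : (D : ℝ) ≤ 2 ^ (b * (d * d)) := by exact_mod_cast hD2
  have hD0 : (D : K) ≠ 0 := by exact_mod_cast (by omega : D ≠ 0)
  have hd1 : (1 : ℝ) ≤ d := by exact_mod_cast hd
  have h2b : (1 : ℝ) ≤ 2 ^ b := one_le_pow₀ (by norm_num)
  have hNK : ∀ i j, ((N i j : ℤ) : K) = D * algebraMap ℚ K (A i j) := by
    intro i j
    have := congrArg (algebraMap ℚ K) (hN i j)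
    rwa [map_mul, map_intCast, map_natCast] at this
  have hNR : ∀ i j, |((N i j : ℤ) : ℝ)| ≤ 2 ^ (b * (d * d)) * 2 ^ b := by
    intro i j
    have h1 : ((N i j : ℤ) : ℝ) = D * (A i j : ℝ) := by exact_mod_cast congrArg (Rat.cast : ℚ → ℝ) (hN i j)
    rw [h1, abs_mul, Nat.abs_cast]
    exact mul_le_mul hDR (jhb_rat_abs (hA i j)) (abs_nonneg _) (by positivity)
  have hbN : ∀ i j, JhbBd (2 ^ (b * (d * d)) * 2 ^ b) ((N i j : ℤ) : K) :=
    fun i j => (jhbBd_intCast _).mono (hNR i j)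
  have hbJ : ∀ i j, JhbBd (2 ^ (b * (d * d)) * (d * 2 ^ b)) ((D : K) * J i j) := by
    intro i j
    have hone : (1 : ℝ) ≤ d * 2 ^ b := one_le_mul_of_one_le_of_one_le hd1 h2b
    by_cases h1 : (j : ℕ) = i
    · have : j = i := Fin.ext h1
      subst this
      refine (jhb_Dlam A hA D N hN (hJ4 j)).mono ?_
      exact mul_le_mul_of_nonneg_right hDR (by positivity)
    · by_cases h2 : (j : ℕ) = i + 1
      · rcases hJ2 i j h2 with h | h
        · rw [h, mul_zero]; exact jhbBd_zero (by positivity)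
        · rw [h, mul_one]
          refine (jhbBd_natCast D).mono (hDR.trans ?_)
          exact le_mul_of_one_le_right (by positivity) hone
      · rw [hJ1 i j h1 h2, mul_zero]; exact jhbBd_zero (by positivity)
  let M : Matrix (Fin d × Fin d) (Fin d × Fin d) K := fun p q =>
    (if p.2 = q.2 then ((N p.1 q.1 : ℤ) : K) else 0) - (if p.1 = q.1 then (D : K) * J q.2 p.2 else 0)
  have hMX : ∀ X : Matrix (Fin d) (Fin d) K, ∀ i j, M.mulVec (fun p => X p.1 p.2) (i, j) =
      (D : K) * ((A.map (algebraMap ℚ K) * X) i j - (X * J) i j) := by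
    intro X i j
    simp only [Matrix.mulVec, dotProduct, M, Fintype.sum_prod_type, sub_mul, Finset.sum_sub_distrib,
      ite_mul, zero_mul, Finset.sum_ite_eq, Finset.mem_univ, if_true, Matrix.mul_apply, mul_sub,
      Finset.mul_sum, Matrix.map_apply]
    congr 1
    · apply Finset.sum_congr rfl
      intro k _
      rw [hNK, mul_assoc]
    · rw [Finset.sum_comm]
      simp only [Finset.sum_ite_eq, Finset.mem_univ, if_true]
      apply Finset.sum_congr rfl
      intro k _
      ring
  have hMX0 : ∀ X : Matrix (Fin d) (Fin d) K, M.mulVec (fun p => X p.1 p.2) = 0 ↔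
      A.map (algebraMap ℚ K) * X = X * J := by
    intro X
    constructor
    · intro h
      ext i j
      have := congrFun h (i, j)
      rw [hMX] at this
      rcases mul_eq_zero.mp this with h | h
      · exact absurd h hD0
      · exact sub_eq_zero.mp h
    · intro h
      ext ⟨i, j⟩
      rw [hMX, h]; simp
  have hbd2 : d ≤ b * d ^ 2 := by nlinarith [Nat.mul_le_mul hb (Nat.mul_le_mul hd (le_refl d))]
  have hbd3 : b ≤ b * d ^ 2 := Nat.le_mul_of_pos_right _ (by positivity)
  have hd2 : (d : ℝ) + 1 ≤ 2 ^ d := by exact_mod_cast Nat.lt_two_pow_self (n := d)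
  have hbM : ∀ p q, JhbBd (2 ^ (3 * b * d ^ 2)) (M p q) := by
    intro p q
    have h1 : JhbBd (2 ^ (b * (d * d)) * 2 ^ b) (if p.2 = q.2 then ((N p.1 q.1 : ℤ) : K) else 0) := by
      split_ifs
      · exact hbN _ _
      · exact jhbBd_zero (by positivity)
    have h2 : JhbBd (2 ^ (b * (d * d)) * (d * 2 ^ b))
        (if p.1 = q.1 then (D : K) * J q.2 p.2 else 0) := by
      split_ifs
      · exact hbJ _ _
      · exact jhbBd_zero (by positivity)
    refine (h1.sub h2).mono ?_
    calc (2 : ℝ) ^ (b * (d * d)) * 2 ^ b + 2 ^ (b * (d * d)) * (d * 2 ^ b)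
        = 2 ^ (b * (d * d)) * 2 ^ b * (d + 1) := by ring
      _ ≤ 2 ^ (b * (d * d)) * 2 ^ b * 2 ^ d := by gcongr
      _ = 2 ^ (b * (d * d) + b + d) := by rw [pow_add, pow_add]
      _ ≤ 2 ^ (3 * b * d ^ 2) := by
        apply pow_le_pow_right₀ (by norm_num)
        nlinarith
  obtain ⟨W, s, X, hW, hs, hX, hXdet, hMX'⟩ := jhb_kernel M V0 hV0 ((hMX0 V0).mpr hAV)
  refine ⟨X, J, hXdet, (hMX0 X).mp hMX', hJ1, hJ2, hJ3, ?_⟩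
  have hbW : ∀ p q, JhbBd (2 ^ (3 * b * d ^ 2)) (W p q) := by
    intro p q
    rcases hW p with ⟨i, hi⟩ | ⟨j, hj⟩
    · rw [hi]; exact hbM i q
    · rw [hj]
      by_cases h : q = j
      · subst h; simpa using jhbBd_one (one_le_pow₀ (by norm_num))
      · simpa [h] using jhbBd_zero (by positivity)
  have hd2' : (d : ℝ) ≤ 2 ^ d := by linarith
  have hbadj : ∀ p q, JhbBd (2 ^ (5 * b * d ^ 4)) (W.adjugate p q) := by
    intro p q
    refine (jhbBd_adjugate (one_le_pow₀ (by norm_num)) hbW p q).mono ?_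
    rw [Fintype.card_prod, Fintype.card_fin]
    have h1 : ((d * d).factorial : ℝ) ≤ ((d : ℝ) * d) ^ (d * d) := by
      exact_mod_cast Nat.factorial_le_pow (d * d)
    calc ((d * d).factorial : ℝ) * (2 ^ (3 * b * d ^ 2)) ^ (d * d)
        ≤ (2 ^ d * 2 ^ d) ^ (d * d) * (2 ^ (3 * b * d ^ 2)) ^ (d * d) := by
          gcongr
          refine h1.trans ?_
          gcongr
      _ = 2 ^ ((d + d + 3 * b * d ^ 2) * (d * d)) := by
          rw [← pow_add, ← mul_pow, ← pow_add, ← pow_mul]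
      _ ≤ 2 ^ (5 * b * d ^ 4) := by
          apply pow_le_pow_right₀ (by norm_num)
          calc (d + d + 3 * b * d ^ 2) * (d * d) ≤ (5 * b * d ^ 2) * (d * d) :=
                Nat.mul_le_mul_right _ (by nlinarith)
            _ = _ := by ring
  intro i j
  rw [hX]
  have h1 : ∀ k, JhbBd (2 ^ (5 * b * d ^ 4) * d) (W.adjugate (i, j) k * (s k : K)) := fun k =>
    (hbadj (i, j) k).mul ((jhbBd_natCast (s k)).mono (by exact_mod_cast hs k)) (by positivity)
  refine (jhbBd_sum h1).mono ?_
  rw [Fintype.card_prod, Fintype.card_fin]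
  push_cast
  calc (d : ℝ) * d * (2 ^ (5 * b * d ^ 4) * d) ≤ 2 ^ d * 2 ^ d * (2 ^ (5 * b * d ^ 4) * 2 ^ d) := by
        gcongr
    _ = 2 ^ (d + d + (5 * b * d ^ 4 + d)) := by rw [← pow_add, ← pow_add, ← pow_add]
    _ ≤ 2 ^ (8 * b * d ^ 4) := by
        apply pow_le_pow_right₀ (by norm_num)
        have : d ≤ b * d ^ 4 := by
          calc d = 1 * d ^ 1 := by simp
            _ ≤ b * d ^ 4 := Nat.mul_le_mul hb (Nat.pow_le_pow_right hd (by norm_num))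
        nlinarith

open Polynomial in
theorem jhb_alg_R {d b : ℕ} (hd : 1 ≤ d) (hb : 1 ≤ b)
    (A : Matrix (Fin d) (Fin d) ℚ) (hA : ∀ i j, RatBitSizeLE (A i j) b)
    (hreal : ∀ μ : ℂ, ((A.map (Rat.cast : ℚ → ℝ)).map Complex.ofReal).charpoly.IsRoot μ →
      μ.im = 0) :
    ∃ V J : Matrix (Fin d) (Fin d) ℝ, IsJordanMatrix J ∧
      A.map (Rat.cast : ℚ → ℝ) * V = V * J ∧ V.det ≠ 0 ∧
      (∀ i j, |V i j| ≤ 2 ^ (8 * b * d ^ 4)) ∧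
      1 ≤ |V.det| * (2 ^ (9 * b * d ^ 5)) ^ (d ^ d) := by
  have hspR : (A.charpoly.map (algebraMap ℚ ℝ)).Splits := by
    have h1 : A.map (Rat.cast : ℚ → ℝ) = A.map (algebraMap ℚ ℝ) := by ext i j; simp
    have h2 : ((A.map (Rat.cast : ℚ → ℝ)).map Complex.ofReal).charpoly =
        (A.charpoly.map (algebraMap ℚ ℝ)).map Complex.ofRealHom := by
      rw [← Matrix.charpoly_map, ← Matrix.charpoly_map, h1]; rfl
    rw [h2] at hreal
    refine Splits.of_splits_map Complex.ofRealHom (IsAlgClosed.splits _) ?_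
    intro a ha
    have := hreal a (isRoot_of_mem_roots ha)
    exact ⟨a.re, Complex.ext (by simp) (by simp [this])⟩
  obtain ⟨K, iF, iA, iS⟩ : ∃ (K : Type) (_ : Field K) (_ : Algebra ℚ K),
      IsSplittingField ℚ K A.charpoly :=
    ⟨A.charpoly.SplittingField, inferInstance, _,
      IsSplittingField.splittingField A.charpoly⟩
  have : FiniteDimensional ℚ K := IsSplittingField.finiteDimensional K A.charpoly
  let τ : K →ₐ[ℚ] ℝ := IsSplittingField.lift K A.charpoly hspR
  let σ₀ : K →ₐ[ℚ] ℂ := (Complex.ofRealHom.toRatAlgHom).comp τ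
  have hσ : ∀ x, ‖σ₀ x‖ = |τ x| := by
    intro x
    have : σ₀ x = ((τ x : ℝ) : ℂ) := rfl
    rw [this]; simp
  have hsp : (A.map (algebraMap ℚ K)).charpoly.Splits := by
    rw [Matrix.charpoly_map]; exact IsSplittingField.splits K A.charpoly
  obtain ⟨V, J, hV, hAV, hJ1, hJ2, hJ3, hbV⟩ := jhb_alg_K hd hb A hA hsp
  have hcard : Nat.card (K →ₐ[ℚ] ℂ) ≤ d ^ d :=
    jhb_card_emb K A.charpoly hd (by rw [Matrix.charpoly_natDegree_eq_dim, Fintype.card_fin])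
  have hdet : (V.map τ).det = τ V.det := (AlgHom.map_det τ V).symm
  refine ⟨V.map τ, J.map τ, ⟨?_, ?_, ?_⟩, ?_, ?_, ?_, ?_⟩
  · intro i j h1 h2
    rw [Matrix.map_apply, hJ1 i j h1 h2, map_zero]
  · intro i j h1
    rcases hJ2 i j h1 with h | h
    · left; rw [Matrix.map_apply, h, map_zero]
    · right; rw [Matrix.map_apply, h, map_one]
  · intro i j h1 h2
    rw [Matrix.map_apply] at h2
    have h3 : J i j = 1 := (map_eq_one_iff τ τ.toRingHom.injective).mp h2
    rw [Matrix.map_apply, Matrix.map_apply, hJ3 i j h1 h3]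
  · have h1 : A.map (Rat.cast : ℚ → ℝ) = (A.map (algebraMap ℚ K)).map τ := by
      ext i j; simp
    rw [h1]
    have := congrArg (fun X => X.map τ) hAV
    simpa only [Matrix.map_mul] using this
  · rw [hdet]; exact (map_ne_zero τ).mpr hV
  · intro i j
    have := (hbV i j).2 σ₀
    rwa [hσ] at this
  · rw [hdet, ← hσ]
    refine jhbBd_lower (one_le_pow₀ (by norm_num)) hV ((jhbBd_det hbV).mono ?_) hcard σ₀
    rw [Fintype.card_fin]
    have h1 : (d.factorial : ℝ) ≤ (d : ℝ) ^ d := by exact_mod_cast Nat.factorial_le_pow d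
    have hd2 : (d : ℝ) ≤ 2 ^ d := by exact_mod_cast (Nat.lt_two_pow_self (n := d)).le
    calc (d.factorial : ℝ) * (2 ^ (8 * b * d ^ 4)) ^ d
        ≤ (2 ^ d) ^ d * (2 ^ (8 * b * d ^ 4)) ^ d := by
          gcongr
          refine h1.trans ?_
          gcongr
      _ = 2 ^ ((d + 8 * b * d ^ 4) * d) := by rw [← mul_pow, ← pow_add, ← pow_mul]
      _ ≤ 2 ^ (9 * b * d ^ 5) := by
        apply pow_le_pow_right₀ (by norm_num)
        have : d ≤ b * d ^ 4 := by
          calc d = 1 * d ^ 1 := by simp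
            _ ≤ b * d ^ 4 := Nat.mul_le_mul hb (Nat.pow_le_pow_right hd (by norm_num))
        calc (d + 8 * b * d ^ 4) * d ≤ (9 * b * d ^ 4) * d :=
              Nat.mul_le_mul_right _ (by nlinarith)
          _ = _ := by ring

/-- An optimum of a linear functional on a polyhedron is attained at a vertex. -/
theorem jhb_opt_vertex {ι κ : Type*} [Fintype ι] [Fintype κ] (B : Matrix ι κ ℝ) (c : ι → ℝ)
    (f : (κ → ℝ) →ₗ[ℝ] ℝ) (x0 : κ → ℝ) (hx0 : ∀ i, B.mulVec x0 i ≤ c i)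
    (hc : IsCompact {x : κ → ℝ | (∀ i, B.mulVec x i ≤ c i) ∧ f x ≤ f x0}) :
    ∃ x : κ → ℝ, (∀ i, B.mulVec x i ≤ c i) ∧ (∀ y : κ → ℝ, (∀ i, B.mulVec y i ≤ c i) → f x ≤ f y) ∧
      (∀ v : κ → ℝ, (∀ i, B.mulVec x i = c i → B.mulVec v i = 0) → v = 0) := by
  have hfc : Continuous f := f.continuous_of_finiteDimensional
  obtain ⟨x1, hx1, hmin⟩ := hc.exists_isMinOn ⟨x0, hx0, le_rfl⟩ hfc.continuousOn
  have hmin' : ∀ y : κ → ℝ, (∀ i, B.mulVec y i ≤ c i) → f x1 ≤ f y := by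
    intro y hy
    by_cases h : f y ≤ f x0
    · exact hmin ⟨hy, h⟩
    · push Not at h
      exact hx1.2.trans h.le
  set F : Set (κ → ℝ) := {x : κ → ℝ | (∀ i, B.mulVec x i ≤ c i) ∧ f x ≤ f x0} ∩ {x | f x ≤ f x1}
    with hF
  have hFc : IsCompact F := hc.inter_right (isClosed_le hfc continuous_const)
  obtain ⟨x, hxF, hext⟩ := hFc.extremePoints_nonempty ⟨x1, hx1, le_refl (f x1)⟩
  have hxmin : f x = f x1 := le_antisymm hxF.2 (hmin' x hxF.1.1)
  refine ⟨x, hxF.1.1, fun y hy => hxmin ▸ hmin' y hy, ?_⟩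
  intro v hv
  by_contra hv0
  -- small step in the direction of v
  have hstep : ∃ s : ℝ, 0 < s ∧ ∀ i, B.mulVec x i + s * |B.mulVec v i| ≤ c i := by
    have hloc : ∀ i, ∀ᶠ s : ℝ in nhdsWithin 0 (Set.Ioi 0),
        B.mulVec x i + s * |B.mulVec v i| ≤ c i := by
      intro i
      rcases (hxF.1.1 i).eq_or_lt with h | h
      · rw [hv i h]; simp [h]
      · have hcont : Filter.Tendsto (fun s : ℝ => B.mulVec x i + s * |B.mulVec v i|)
            (nhdsWithin 0 (Set.Ioi 0)) (nhds (B.mulVec x i + 0 * |B.mulVec v i|)) := by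
          apply Filter.Tendsto.mono_left _ nhdsWithin_le_nhds
          exact Continuous.tendsto (by fun_prop) 0
        have := hcont.eventually (gt_mem_nhds (by simpa using h : B.mulVec x i + 0 * |B.mulVec v i| < c i))
        exact this.mono fun s hs => hs.le
    have hall := Filter.eventually_all.mpr hloc
    obtain ⟨s, hs1, hs2⟩ := (hall.and self_mem_nhdsWithin).exists
    exact ⟨s, hs2, hs1⟩
  obtain ⟨s, hs, hsB⟩ := hstep
  have hp : ∀ i, B.mulVec (x + s • v) i ≤ c i := by
    intro i
    rw [Matrix.mulVec_add, Matrix.mulVec_smul, Pi.add_apply, Pi.smul_apply, smul_eq_mul]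
    have := hsB i
    nlinarith [le_abs_self (B.mulVec v i)]
  have hm : ∀ i, B.mulVec (x - s • v) i ≤ c i := by
    intro i
    rw [Matrix.mulVec_sub, Matrix.mulVec_smul, Pi.sub_apply, Pi.smul_apply, smul_eq_mul]
    have := hsB i
    nlinarith [neg_le_abs (B.mulVec v i)]
  have hfp := hmin' _ hp
  have hfm := hmin' _ hm
  rw [map_add] at hfp
  rw [map_sub] at hfm
  have hfx0 : f x1 ≤ f x0 := hx1.2
  have hpF : x + s • v ∈ F := ⟨⟨hp, by rw [map_add]; linarith⟩, by
    show f _ ≤ _; rw [map_add]; linarith⟩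
  have hmF : x - s • v ∈ F := ⟨⟨hm, by rw [map_sub]; linarith⟩, by
    show f _ ≤ _; rw [map_sub]; linarith⟩
  have hseg : x ∈ openSegment ℝ (x + s • v) (x - s • v) :=
    ⟨1 / 2, 1 / 2, by norm_num, by norm_num, by norm_num, by
      ext i; simp; ring⟩
  have := hext hpF hmF hseg
  apply hv0
  have h2 : s • v = 0 := by simpa using this
  exact (smul_eq_zero.mp h2).resolve_left hs.ne'

theorem jhb_rat_det {κ : Type*} [Fintype κ] [DecidableEq κ] {b : ℕ} (G : Matrix κ κ ℚ)
    (hG : ∀ i j, RatBitSizeLE (G i j) b) :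
    |(G.det : ℝ)| ≤ (Fintype.card κ).factorial * (2 ^ b) ^ (Fintype.card κ) ∧
    (G.det ≠ 0 → 1 ≤ |(G.det : ℝ)| * 2 ^ (b * (Fintype.card κ * Fintype.card κ) * Fintype.card κ)) := by
  constructor
  · have h1 : (G.det : ℝ) = (G.map (Rat.castHom ℝ)).det := RingHom.map_det (Rat.castHom ℝ) G
    rw [h1]
    have := Matrix.det_le (A := G.map (Rat.castHom ℝ)) (abv := AbsoluteValue.abs) (x := 2 ^ b)
      (fun i j => jhb_rat_abs (hG i j))
    rw [nsmul_eq_mul] at this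
    exact this
  · intro hne
    obtain ⟨D, N, hD1, hD2, hN⟩ := jhb_common_den (fun i j => G i j) hG
    have h1 : (((Matrix.of N).det : ℤ) : ℚ) = D ^ (Fintype.card κ) * G.det := by
      rw [← Matrix.det_smul]
      have := RingHom.map_det (Int.castRingHom ℚ) (Matrix.of N)
      rw [eq_intCast] at this
      rw [this]
      congr 1
      ext i j
      simp [hN]
    have h2 : (Matrix.of N).det ≠ 0 := by
      intro h
      rw [h, Int.cast_zero] at h1
      have hD0 : (D : ℚ) ≠ 0 := by exact_mod_cast (by omega : D ≠ 0)
      exact (mul_ne_zero (pow_ne_zero _ hD0) hne) h1.symm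
    have h3 : (1 : ℝ) ≤ |(((Matrix.of N).det : ℤ) : ℝ)| := by exact_mod_cast Int.one_le_abs h2
    have h4 : (((Matrix.of N).det : ℤ) : ℝ) = D ^ (Fintype.card κ) * (G.det : ℝ) := by
      have := congrArg (Rat.cast : ℚ → ℝ) h1
      rw [Rat.cast_intCast, Rat.cast_mul, Rat.cast_pow, Rat.cast_natCast] at this
      exact this
    rw [h4, abs_mul, abs_of_nonneg (by positivity : (0 : ℝ) ≤ (D : ℝ) ^ Fintype.card κ), mul_comm] at h3
    refine h3.trans (mul_le_mul_of_nonneg_left ?_ (abs_nonneg _))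
    rw [pow_mul]
    have : (D : ℝ) ≤ 2 ^ (b * (Fintype.card κ * Fintype.card κ)) := by exact_mod_cast hD2
    gcongr

theorem jhb_vertex_bound {ι κ : Type*} [Fintype κ] [DecidableEq κ] {b : ℕ}
    (B : Matrix ι κ ℚ) (c : ι → ℚ) (hB : ∀ i j, RatBitSizeLE (B i j) b)
    (hc : ∀ i, RatBitSizeLE (c i) b) (x : κ → ℝ)
    (hx : ∀ v : κ → ℝ, (∀ i, (B.map (Rat.cast : ℚ → ℝ)).mulVec x i = c i →
      (B.map (Rat.cast : ℚ → ℝ)).mulVec v i = 0) → v = 0) (j : κ) :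
    |x j| ≤ (Fintype.card κ).factorial * (2 ^ b) ^ (Fintype.card κ) *
      2 ^ (b * (Fintype.card κ * Fintype.card κ) * Fintype.card κ) ∧
    (x j ≠ 0 → 1 ≤ |x j| * ((Fintype.card κ).factorial * (2 ^ b) ^ (Fintype.card κ) *
      2 ^ (b * (Fintype.card κ * Fintype.card κ) * Fintype.card κ))) := by
  let Act := {i // (B.map (Rat.cast : ℚ → ℝ)).mulVec x i = c i}
  let M : Matrix Act κ ℝ := fun i => B.map (Rat.cast : ℚ → ℝ) i.1
  obtain ⟨W, F, hW, hF1, hF2, hF3⟩ := jhb_row_sel M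
  have hall : ∀ k, k ∈ F := by
    intro k
    by_contra hk
    have h1 := hF3 (W.adjugate.mulVec (Pi.single k 1)) (by
      intro l hl
      rw [Matrix.mulVec_mulVec, Matrix.mul_adjugate, Matrix.smul_mulVec, Matrix.one_mulVec]
      have : l ≠ k := fun h => hk (h ▸ hl)
      simp [this])
    have h2 := hx _ (fun i hi => congrFun h1 ⟨i, hi⟩)
    have h3 := congrArg (fun y => W.mulVec y k) h2
    simp only [Matrix.mulVec_mulVec, Matrix.mul_adjugate, Matrix.smul_mulVec, Matrix.one_mulVec] at h3
    simp [hW] at h3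
  choose r hr using fun k => hF1 k (hall k)
  let G : Matrix κ κ ℚ := fun k => B (r k).1
  let g : κ → ℚ := fun k => c (r k).1
  have hWG : W = G.map (Rat.castHom ℝ) := by
    ext k l; rw [hr k]; rfl
  have hWx : W.mulVec x = fun k => (g k : ℝ) := by
    ext k
    have h1 := (r k).2
    simp only [Matrix.mulVec] at h1 ⊢
    rw [hr k]; exact h1
  let G' : Matrix κ κ ℚ := G.updateCol j g
  have hcr : W.det * x j = (G'.det : ℝ) := by
    have h1 : W.cramer (W.mulVec x) j = W.det * x j := by
      rw [Matrix.cramer_eq_adjugate_mulVec, Matrix.mulVec_mulVec, Matrix.adjugate_mul,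
        Matrix.smul_mulVec, Matrix.one_mulVec]; rfl
    rw [← h1, Matrix.cramer_apply, hWx]
    have h2 : (G'.det : ℝ) = (G'.map (Rat.castHom ℝ)).det := RingHom.map_det (Rat.castHom ℝ) G'
    rw [h2, hWG]
    congr 1
    ext k l
    by_cases hl : l = j
    · subst hl; simp [G']
    · simp [G', hl]
  have hdetG : W.det = (G.det : ℝ) := by
    rw [hWG]; exact (RingHom.map_det (Rat.castHom ℝ) G).symm
  have hG := jhb_rat_det G (b := b) (fun i j => hB _ _)
  have hG' := jhb_rat_det G' (b := b) (fun k l => by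
    by_cases hl : l = j
    · subst hl; simpa [G', g] using hc _
    · rw [show G' k l = B (r k).1 l from Matrix.updateCol_ne hl]
      exact hB _ _)
  have hGne : G.det ≠ 0 := by
    intro h; apply hW; rw [hdetG, h, Rat.cast_zero]
  have hG1 := hG.2 hGne
  rw [hdetG] at hcr
  have habs : |(G.det : ℝ)| * |x j| = |(G'.det : ℝ)| := by rw [← abs_mul, hcr]
  set P := (2 : ℝ) ^ (b * (Fintype.card κ * Fintype.card κ) * Fintype.card κ) with hP
  set U := ((Fintype.card κ).factorial : ℝ) * (2 ^ b) ^ (Fintype.card κ) with hU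
  have hPpos : 0 < P := by positivity
  constructor
  · calc |x j| = 1 * |x j| := by ring
      _ ≤ (|(G.det : ℝ)| * P) * |x j| := by gcongr
      _ = |(G'.det : ℝ)| * P := by rw [← habs]; ring
      _ ≤ U * P := by gcongr; exact hG'.1
  · intro hxj
    have hG'ne : G'.det ≠ 0 := by
      intro h
      rw [h, Rat.cast_zero] at hcr
      rcases mul_eq_zero.mp hcr with h | h
      · exact hGne (by exact_mod_cast h)
      · exact hxj h
    calc 1 ≤ |(G'.det : ℝ)| * P := hG'.2 hG'ne
      _ = |(G.det : ℝ)| * |x j| * P := by rw [habs]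
      _ ≤ U * |x j| * P := by gcongr; exact hG.1
      _ = _ := by ring

theorem jhb_poly_R {d n b : ℕ} (B : Matrix (Fin n) (Fin d) ℚ) (c : Fin n → ℚ)
    (hB : ∀ i j, RatBitSizeLE (B i j) b) (hc : ∀ i, RatBitSizeLE (c i) b)
    (hcompact : IsCompact {x : Fin d → ℝ | ∀ i, (B.map (Rat.cast : ℚ → ℝ)).mulVec x i ≤ (c i : ℝ)})
    (x : Fin d → ℝ) (hx : ∀ i, (B.map (Rat.cast : ℚ → ℝ)).mulVec x i ≤ (c i : ℝ)) (j : Fin d) :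
    |x j| ≤ d.factorial * (2 ^ b) ^ d * 2 ^ (b * (d * d) * d) := by
  have key : ∀ f : (Fin d → ℝ) →ₗ[ℝ] ℝ,
      ∃ y : Fin d → ℝ, f y ≤ f x ∧ |y j| ≤ d.factorial * (2 ^ b) ^ d * 2 ^ (b * (d * d) * d) := by
    intro f
    have hfc : Continuous f := f.continuous_of_finiteDimensional
    obtain ⟨y, hy1, hy2, hy3⟩ := jhb_opt_vertex (B.map (Rat.cast : ℚ → ℝ)) (fun i => (c i : ℝ)) f x hx
      (hcompact.inter_right (isClosed_le hfc continuous_const))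
    refine ⟨y, hy2 x hx, ?_⟩
    have := (jhb_vertex_bound B c hB hc y hy3 j).1
    simpa only [Fintype.card_fin] using this
  obtain ⟨y, hy1, hy2⟩ := key (LinearMap.proj j)
  obtain ⟨z, hz1, hz2⟩ := key (-LinearMap.proj j)
  simp only [LinearMap.proj_apply, LinearMap.neg_apply] at hy1 hz1
  rw [abs_le] at *
  constructor <;> linarith

theorem jhb_rat_zero (b : ℕ) : RatBitSizeLE 0 b := ⟨by simp, by simpa using Nat.one_le_two_pow⟩

theorem jhb_rat_one (b : ℕ) : RatBitSizeLE 1 b :=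
  ⟨by simpa using one_le_pow₀ (by norm_num : (1 : ℤ) ≤ 2), by simpa using Nat.one_le_two_pow⟩

theorem jhb_rat_neg {q : ℚ} {b : ℕ} (h : RatBitSizeLE q b) : RatBitSizeLE (-q) b := by
  refine ⟨?_, ?_⟩
  · rw [Rat.neg_num, abs_neg]; exact h.1
  · rw [Rat.den_neg_eq_den]; exact h.2

/-- The lifted system `B x ≤ c`, `A x ≤ t`, `-A x ≤ t`. -/
def jhbLift {d n : ℕ} (A : Matrix (Fin d) (Fin d) ℚ) (B : Matrix (Fin n) (Fin d) ℚ) :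
    Matrix (Fin n ⊕ (Fin d ⊕ Fin d)) (Option (Fin d)) ℚ
  | Sum.inl i, o => o.elim 0 (fun j => B i j)
  | Sum.inr (Sum.inl i), o => o.elim (-1) (fun j => A i j)
  | Sum.inr (Sum.inr i), o => o.elim (-1) (fun j => -A i j)

theorem jhb_poly_eta {d n b : ℕ} (hd : 1 ≤ d) (A : Matrix (Fin d) (Fin d) ℚ)
    (B : Matrix (Fin n) (Fin d) ℚ) (c : Fin n → ℚ) (hA : ∀ i j, RatBitSizeLE (A i j) b)
    (hB : ∀ i j, RatBitSizeLE (B i j) b) (hc : ∀ i, RatBitSizeLE (c i) b)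
    (hcompact : IsCompact {x : Fin d → ℝ | ∀ i, (B.map (Rat.cast : ℚ → ℝ)).mulVec x i ≤ (c i : ℝ)})
    (hnofix : ∀ x : Fin d → ℝ, (∀ i, (B.map (Rat.cast : ℚ → ℝ)).mulVec x i ≤ (c i : ℝ)) →
      (A.map (Rat.cast : ℚ → ℝ)).mulVec x ≠ 0)
    (x : Fin d → ℝ) (hx : ∀ i, (B.map (Rat.cast : ℚ → ℝ)).mulVec x i ≤ (c i : ℝ)) :
    ∃ i, 1 ≤ |(A.map (Rat.cast : ℚ → ℝ)).mulVec x i| * ((d + 1).factorial * (2 ^ b) ^ (d + 1) *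
      2 ^ (b * ((d + 1) * (d + 1)) * (d + 1))) := by
  have : Nonempty (Fin d) := ⟨⟨0, hd⟩⟩
  obtain ⟨i0, hi0⟩ := Finite.exists_max (fun i => |(A.map (Rat.cast : ℚ → ℝ)).mulVec x i|)
  refine ⟨i0, ?_⟩
  set t0 := |(A.map (Rat.cast : ℚ → ℝ)).mulVec x i0| with ht0
  set B' := jhbLift A B with hB'
  let c' : Fin n ⊕ (Fin d ⊕ Fin d) → ℚ := Sum.elim c (fun _ => 0)
  have hfeas : ∀ y : Option (Fin d) → ℝ, (∀ i, (B'.map (Rat.cast : ℚ → ℝ)).mulVec y i ≤ (c' i : ℝ)) ↔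
      (∀ i, (B.map (Rat.cast : ℚ → ℝ)).mulVec (fun j => y (some j)) i ≤ (c i : ℝ)) ∧
      ∀ i, |(A.map (Rat.cast : ℚ → ℝ)).mulVec (fun j => y (some j)) i| ≤ y none := by
    intro y
    have e1 : ∀ i, (B'.map (Rat.cast : ℚ → ℝ)).mulVec y (Sum.inl i) =
        (B.map (Rat.cast : ℚ → ℝ)).mulVec (fun j => y (some j)) i := by
      intro i
      simp [Matrix.mulVec, dotProduct, Fintype.sum_option, hB', jhbLift]
    have e2 : ∀ i, (B'.map (Rat.cast : ℚ → ℝ)).mulVec y (Sum.inr (Sum.inl i)) =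
        (A.map (Rat.cast : ℚ → ℝ)).mulVec (fun j => y (some j)) i - y none := by
      intro i
      simp [Matrix.mulVec, dotProduct, Fintype.sum_option, hB', jhbLift]; ring
    have e3 : ∀ i, (B'.map (Rat.cast : ℚ → ℝ)).mulVec y (Sum.inr (Sum.inr i)) =
        -(A.map (Rat.cast : ℚ → ℝ)).mulVec (fun j => y (some j)) i - y none := by
      intro i
      simp [Matrix.mulVec, dotProduct, Fintype.sum_option, hB', jhbLift]; ring
    simp only [Sum.forall, e1, e2, e3, c', Sum.elim_inl, Sum.elim_inr, Rat.cast_zero, abs_le]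
    constructor
    · rintro ⟨h1, h2, h3⟩
      exact ⟨h1, fun i => ⟨by linarith [h3 i], by linarith [h2 i]⟩⟩
    · rintro ⟨h1, h2⟩
      exact ⟨h1, fun i => by linarith [(h2 i).2], fun i => by linarith [(h2 i).1]⟩
  let f : (Option (Fin d) → ℝ) →ₗ[ℝ] ℝ := LinearMap.proj none
  let x' : Option (Fin d) → ℝ := fun o => o.elim t0 x
  have hx' : ∀ i, (B'.map (Rat.cast : ℚ → ℝ)).mulVec x' i ≤ (c' i : ℝ) :=
    (hfeas x').mpr ⟨hx, hi0⟩
  have hcomp : IsCompact {y : Option (Fin d) → ℝ |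
      (∀ i, (B'.map (Rat.cast : ℚ → ℝ)).mulVec y i ≤ (c' i : ℝ)) ∧ f y ≤ f x'} := by
    have hbig := (hcompact.prod (isCompact_Icc (a := (0 : ℝ)) (b := t0))).image
      (f := fun p : (Fin d → ℝ) × ℝ => (fun o : Option (Fin d) => o.elim p.2 p.1)) (by
        apply continuous_pi
        intro o
        cases o with
        | none => exact continuous_snd
        | some j => exact (continuous_apply j).comp continuous_fst)
    refine hbig.of_isClosed_subset ?_ ?_
    · have h1 : Continuous f := f.continuous_of_finiteDimensional
      refine IsClosed.inter ?_ (isClosed_le h1 continuous_const)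
      have : {y : Option (Fin d) → ℝ | ∀ i, (B'.map (Rat.cast : ℚ → ℝ)).mulVec y i ≤ (c' i : ℝ)} =
        ⋂ i, {y | (B'.map (Rat.cast : ℚ → ℝ)).mulVec y i ≤ (c' i : ℝ)} := by
          ext y; simp
      show IsClosed {y : Option (Fin d) → ℝ | ∀ i, (B'.map (Rat.cast : ℚ → ℝ)).mulVec y i ≤ (c' i : ℝ)}
      rw [this]
      refine isClosed_iInter fun i => isClosed_le ?_ continuous_const
      exact (continuous_apply i).comp (Continuous.matrix_mulVec continuous_const continuous_id)
    · rintro y ⟨hy1, hy2⟩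
      obtain ⟨h1, h2⟩ := (hfeas y).mp hy1
      refine ⟨(fun j => y (some j), y none), ⟨h1, (abs_nonneg _).trans (h2 i0), hy2⟩, ?_⟩
      ext o
      cases o <;> rfl
  obtain ⟨y, hy1, hy2, hy3⟩ := jhb_opt_vertex (B'.map (Rat.cast : ℚ → ℝ)) (fun i => (c' i : ℝ)) f x' hx' hcomp
  have hbits : ∀ i j, RatBitSizeLE (B' i j) b := by
    rintro (i | i | i) (_ | j)
    · exact jhb_rat_zero b
    · exact hB i j
    · exact jhb_rat_neg (jhb_rat_one b)
    · exact hA i j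
    · exact jhb_rat_neg (jhb_rat_one b)
    · exact jhb_rat_neg (hA i j)
  have hcb : ∀ i, RatBitSizeLE (c' i) b := by
    rintro (i | i)
    · exact hc i
    · exact jhb_rat_zero b
  obtain ⟨h1, h2⟩ := (hfeas y).mp hy1
  have hpos : y none ≠ 0 := by
    intro h0
    refine hnofix _ h1 ?_
    ext i
    have := h2 i
    rw [h0] at this
    exact abs_nonpos_iff.mp this
  have hge : 0 ≤ y none := (abs_nonneg _).trans (h2 i0)
  have hle : y none ≤ t0 := hy2 x' hx'
  have hv := (jhb_vertex_bound B' c' hbits hcb y hy3 none).2 hpos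
  simp only [Fintype.card_option, Fintype.card_fin] at hv
  rw [abs_of_nonneg hge] at hv
  refine hv.trans ?_
  gcongr

theorem jhb_T_bound {m d b : ℕ} (hd : 1 ≤ d) (hb : 1 ≤ b) (hm : m ≤ 2 * d) :
    (m.factorial : ℝ) * (2 ^ b) ^ m * 2 ^ (b * (m * m) * m) ≤ 2 ^ (14 * b * d ^ 3) := by
  have h1 : (m.factorial : ℝ) ≤ 2 ^ (m * m) := by
    have : m.factorial ≤ 2 ^ (m * m) := by
      calc m.factorial ≤ m ^ m := Nat.factorial_le_pow m
        _ ≤ (2 ^ m) ^ m := Nat.pow_le_pow_left Nat.lt_two_pow_self.le m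
        _ = _ := by rw [pow_mul]
    exact_mod_cast this
  calc (m.factorial : ℝ) * (2 ^ b) ^ m * 2 ^ (b * (m * m) * m)
      ≤ 2 ^ (m * m) * (2 ^ b) ^ m * 2 ^ (b * (m * m) * m) := by gcongr
    _ = 2 ^ (m * m + b * m + b * (m * m) * m) := by rw [pow_add, pow_add, ← pow_mul]
    _ ≤ _ := by
      apply pow_le_pow_right₀ (by norm_num)
      have e1 : m * m + b * m + b * (m * m) * m ≤
          (2 * d) * (2 * d) + b * (2 * d) + b * ((2 * d) * (2 * d)) * (2 * d) := by gcongr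
      have e2 : 1 * (d * d * 1) ≤ b * (d * d * d) := by gcongr
      have e3 : b * (d * 1 * 1) ≤ b * (d * d * d) := by gcongr
      nlinarith

theorem jhb_inv_entry {d : ℕ} (V : Matrix (Fin d) (Fin d) ℝ) {M L : ℝ} (hM : 1 ≤ M)
    (hV : ∀ i j, |V i j| ≤ M) (hdet : 1 ≤ |V.det| * L) (i j : Fin d) :
    |V⁻¹ i j| ≤ d.factorial * M ^ d * L := by
  have hadj : |V.adjugate i j| ≤ d.factorial * M ^ d := by
    rw [Matrix.adjugate_apply]
    have := Matrix.det_le (A := V.updateRow j (Pi.single i 1)) (abv := AbsoluteValue.abs) (x := M)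
      (fun k l => by
        show |V.updateRow j (Pi.single i 1) k l| ≤ M
        by_cases hk : k = j
        · subst hk
          rw [Matrix.updateRow_self]
          by_cases hl : l = i
          · subst hl; simpa using hM
          · simp [hl]; linarith
        · rw [Matrix.updateRow_ne hk]; exact hV k l)
    rw [nsmul_eq_mul, Fintype.card_fin] at this
    exact this
  have hpos : 0 < |V.det| := by
    rcases (abs_nonneg V.det).eq_or_lt with h | h
    · rw [← h] at hdet; norm_num at hdet
    · exact h
  have hinv : |V.det|⁻¹ ≤ L := by
    rw [inv_eq_one_div, div_le_iff₀ hpos]; linarith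
  rw [Matrix.inv_def, Matrix.smul_apply, smul_eq_mul, Ring.inverse_eq_inv', abs_mul, abs_inv, mul_comm]
  have h0 : 0 ≤ |V.adjugate i j| := abs_nonneg _
  calc _ ≤ |V.adjugate i j| * L := by gcongr
    _ ≤ _ := by
      apply mul_le_mul_of_nonneg_right hadj
      exact (inv_nonneg.mpr hpos.le).trans hinv

theorem jhb_mulVec_bound {d : ℕ} (W : Matrix (Fin d) (Fin d) ℝ) (x : Fin d → ℝ) {M R : ℝ}
    (hM : 0 ≤ M) (hW : ∀ i j, |W i j| ≤ M) (hx : ∀ j, |x j| ≤ R) (i : Fin d) :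
    |W.mulVec x i| ≤ d * (M * R) := by
  calc |W.mulVec x i| ≤ ∑ j, |W i j * x j| := by
        simp only [Matrix.mulVec, dotProduct]
        exact Finset.abs_sum_le_sum_abs _ _
    _ ≤ ∑ _j : Fin d, M * R := by
      apply Finset.sum_le_sum
      intro j _
      rw [abs_mul]
      exact mul_le_mul (hW i j) (hx j) (abs_nonneg _) hM
    _ = _ := by simp

/-- **Enclosing and separating hypercubes in the Jordan basis.**
For a compact polytope `P = {x | Bx ≤ c}` with rational data of bit size at most `b`,
whose matrix `A` has only real eigenvalues, and which contains no fixed point of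
`x ↦ Ax`, there are a Jordan basis change `Q` and constants `C ≥ ε > 0` with
`C/ε ≤ exp(640·b·d^(3d+8))` such that `Q·P ⊆ [-C,C]ᵈ` and every `ε`-hypercube
around a fixed point of the Jordan matrix `J = QAQ⁻¹` avoids `Q·P`. -/
theorem jordan_hypercube_bounds (d n b : ℕ) (hd : 1 ≤ d) (hb : 1 ≤ b)
    (A : Matrix (Fin d) (Fin d) ℚ) (B : Matrix (Fin n) (Fin d) ℚ) (c : Fin n → ℚ)
    (hA : ∀ i j, RatBitSizeLE (A i j) b)
    (hB : ∀ i j, RatBitSizeLE (B i j) b)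
    (hc : ∀ i, RatBitSizeLE (c i) b)
    (hreal : ∀ μ : ℂ, ((A.map (Rat.cast : ℚ → ℝ)).map Complex.ofReal).charpoly.IsRoot μ →
      μ.im = 0)
    (P : Set (Fin d → ℝ))
    (hP : P = {x : Fin d → ℝ | ∀ i, (B.map (Rat.cast : ℚ → ℝ)).mulVec x i ≤ (c i : ℝ)})
    (hcompact : IsCompact P)
    (hnofix : ¬ ∃ y ∈ P, (A.map (Rat.cast : ℚ → ℝ)).mulVec y = 0) :
    ∃ Q : Matrix (Fin d) (Fin d) ℝ, IsUnit Q ∧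
      IsJordanMatrix (Q * A.map (Rat.cast : ℚ → ℝ) * Q⁻¹) ∧
      ∃ C ε : ℝ, 0 < ε ∧ ε ≤ C ∧ C / ε ≤ Real.exp (640 * b * d ^ (3 * d + 8)) ∧
        (∀ x ∈ P, ∀ i, |Q.mulVec x i| ≤ C) ∧
        (∀ y : Fin d → ℝ, (Q * A.map (Rat.cast : ℚ → ℝ) * Q⁻¹).mulVec y = 0 →
          ∀ z : Fin d → ℝ, (∀ i, |z i| ≤ ε) → y + z ∉ Q.mulVec '' P) := by
  subst hP
  obtain ⟨V, J, hJ, hAV, hVdet, hVb, hdet⟩ := jhb_alg_R hd hb A hA hreal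
  set A' := A.map (Rat.cast : ℚ → ℝ) with hA'
  have hVu : IsUnit V.det := isUnit_iff_ne_zero.mpr hVdet
  have hVV : V * V⁻¹ = 1 := Matrix.mul_nonsing_inv V hVu
  have hVV' : V⁻¹ * V = 1 := Matrix.nonsing_inv_mul V hVu
  have hconj : V⁻¹ * A' * (V⁻¹)⁻¹ = J := by
    rw [Matrix.nonsing_inv_nonsing_inv V hVu, Matrix.mul_assoc, hAV, ← Matrix.mul_assoc, hVV',
      Matrix.one_mul]
  have hdpow : (d : ℝ) ≤ 2 ^ d := by exact_mod_cast Nat.lt_two_pow_self.le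
  have hR : ∀ x : Fin d → ℝ, (∀ i, (B.map (Rat.cast : ℚ → ℝ)).mulVec x i ≤ (c i : ℝ)) →
      ∀ j, |x j| ≤ 2 ^ (14 * b * d ^ 3) := fun x hx j =>
    (jhb_poly_R B c hB hc hcompact x hx j).trans (jhb_T_bound hd hb (by omega))
  have hη : ∀ x : Fin d → ℝ, (∀ i, (B.map (Rat.cast : ℚ → ℝ)).mulVec x i ≤ (c i : ℝ)) →
      ∃ i, 1 ≤ |A'.mulVec x i| * 2 ^ (14 * b * d ^ 3) := by
    intro x hx
    obtain ⟨i, hi⟩ := jhb_poly_eta hd A B c hA hB hc hcompact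
      (fun y hy h => hnofix ⟨y, hy, h⟩) x hx
    refine ⟨i, hi.trans ?_⟩
    exact mul_le_mul_of_nonneg_left (jhb_T_bound hd hb (by omega)) (abs_nonneg _)
  have hfac : (d.factorial : ℝ) ≤ 2 ^ (d * d) := by
    have : d.factorial ≤ 2 ^ (d * d) := by
      calc d.factorial ≤ d ^ d := Nat.factorial_le_pow d
        _ ≤ (2 ^ d) ^ d := Nat.pow_le_pow_left Nat.lt_two_pow_self.le d
        _ = _ := by rw [pow_mul]
    exact_mod_cast this
  have h1d : ∀ k, 1 ≤ d ^ k := fun k => Nat.one_le_pow _ _ hd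
  refine ⟨V⁻¹, ?_, by rw [hconj]; exact hJ, 2 ^ (33 * b * d ^ (d + 5)), (2 ^ (26 * b * d ^ 4))⁻¹,
    by positivity, ?_, ?_, ?_, ?_⟩
  · exact (Matrix.isUnit_iff_isUnit_det _).mpr (Matrix.isUnit_nonsing_inv_det V hVu)
  · exact (inv_le_one_of_one_le₀ (one_le_pow₀ (by norm_num))).trans (one_le_pow₀ (by norm_num))
  · rw [div_inv_eq_mul, ← pow_add]
    have h2 : (2 : ℝ) ≤ Real.exp 1 := by linarith [Real.add_one_le_exp (1 : ℝ)]
    calc (2 : ℝ) ^ (33 * b * d ^ (d + 5) + 26 * b * d ^ 4)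
        ≤ (Real.exp 1) ^ (33 * b * d ^ (d + 5) + 26 * b * d ^ 4) := by gcongr
      _ = Real.exp ((33 * b * d ^ (d + 5) + 26 * b * d ^ 4 : ℕ) : ℝ) := by
        rw [← Real.exp_nat_mul, mul_one]
      _ ≤ _ := by
        apply Real.exp_le_exp.mpr
        have e1 : d ^ (d + 5) ≤ d ^ (3 * d + 8) := Nat.pow_le_pow_right hd (by omega)
        have e2 : d ^ 4 ≤ d ^ (3 * d + 8) := Nat.pow_le_pow_right hd (by omega)
        have e3 : 33 * b * d ^ (d + 5) + 26 * b * d ^ 4 ≤ 640 * b * d ^ (3 * d + 8) := by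
          calc _ ≤ 33 * b * d ^ (3 * d + 8) + 26 * b * d ^ (3 * d + 8) := by gcongr
            _ = 59 * (b * d ^ (3 * d + 8)) := by ring
            _ ≤ 640 * (b * d ^ (3 * d + 8)) := by gcongr; norm_num
            _ = _ := by ring
        exact_mod_cast e3
  · intro x hx i
    have hent := jhb_inv_entry V (M := 2 ^ (8 * b * d ^ 4)) (one_le_pow₀ (by norm_num)) hVb hdet
    refine (jhb_mulVec_bound V⁻¹ x (by positivity) hent (hR x hx) i).trans ?_
    calc (d : ℝ) * (d.factorial * (2 ^ (8 * b * d ^ 4)) ^ d * (2 ^ (9 * b * d ^ 5)) ^ d ^ d *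
          2 ^ (14 * b * d ^ 3))
        ≤ 2 ^ d * (2 ^ (d * d) * (2 ^ (8 * b * d ^ 4)) ^ d * (2 ^ (9 * b * d ^ 5)) ^ d ^ d *
          2 ^ (14 * b * d ^ 3)) := by gcongr
      _ = 2 ^ (d + (d * d + 8 * b * d ^ 4 * d + 9 * b * d ^ 5 * d ^ d + 14 * b * d ^ 3)) := by
        simp only [pow_add, pow_mul]
      _ ≤ _ := by
        apply pow_le_pow_right₀ (by norm_num)
        set X := d ^ (d + 5) with hX
        have f1 : d ≤ b * X := by
          calc d = 1 * d ^ 1 := by ring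
            _ ≤ b * X := Nat.mul_le_mul hb (Nat.pow_le_pow_right hd (by omega))
        have f2 : d * d ≤ b * X := by
          calc d * d = 1 * d ^ 2 := by ring
            _ ≤ b * X := Nat.mul_le_mul hb (Nat.pow_le_pow_right hd (by omega))
        have f3 : b * d ^ 4 * d ≤ b * X := by
          calc b * d ^ 4 * d = b * d ^ 5 := by ring
            _ ≤ b * X := Nat.mul_le_mul le_rfl (Nat.pow_le_pow_right hd (by omega))
        have f4 : b * d ^ 5 * d ^ d = b * X := by rw [hX, pow_add]; ring
        have f5 : b * d ^ 3 ≤ b * X :=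
          Nat.mul_le_mul le_rfl (Nat.pow_le_pow_right hd (by omega))
        nlinarith
  · rintro y hy z hz ⟨x, hx, hxyz⟩
    rw [hconj] at hy
    have hxV : x = V.mulVec y + V.mulVec z := by
      rw [← Matrix.mulVec_add, ← hxyz, Matrix.mulVec_mulVec, hVV, Matrix.one_mulVec]
    have hAx : A'.mulVec x = A'.mulVec (V.mulVec z) := by
      rw [hxV, Matrix.mulVec_add, Matrix.mulVec_mulVec, hAV, ← Matrix.mulVec_mulVec, hy,
        Matrix.mulVec_zero, zero_add]
    obtain ⟨i, hi⟩ := hη x hx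
    rw [hAx] at hi
    have hVz := jhb_mulVec_bound V z (by positivity) hVb hz
    have hAz := jhb_mulVec_bound A' (V.mulVec z) (M := 2 ^ b) (by positivity)
      (fun i j => jhb_rat_abs (hA i j)) hVz i
    have hlt : (2 : ℝ) ^ (d + (b + (d + 8 * b * d ^ 4)) + 14 * b * d ^ 3) < 2 ^ (26 * b * d ^ 4) := by
      apply pow_lt_pow_right₀ (by norm_num)
      have f1 : d ≤ b * d ^ 4 := by
        calc d = 1 * d ^ 1 := by ring
          _ ≤ _ := Nat.mul_le_mul hb (Nat.pow_le_pow_right hd (by omega))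
      have f2 : b ≤ b * d ^ 4 := Nat.le_mul_of_pos_right _ (h1d 4)
      have f3 : b * d ^ 3 ≤ b * d ^ 4 :=
        Nat.mul_le_mul le_rfl (Nat.pow_le_pow_right hd (by omega))
      nlinarith
    have : (1 : ℝ) < 1 := by
      calc (1 : ℝ) ≤ |A'.mulVec (V.mulVec z) i| * 2 ^ (14 * b * d ^ 3) := hi
        _ ≤ d * (2 ^ b * (d * (2 ^ (8 * b * d ^ 4) * (2 ^ (26 * b * d ^ 4))⁻¹))) *
            2 ^ (14 * b * d ^ 3) := by gcongr
        _ ≤ 2 ^ d * (2 ^ b * (2 ^ d * (2 ^ (8 * b * d ^ 4) * (2 ^ (26 * b * d ^ 4))⁻¹))) *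
            2 ^ (14 * b * d ^ 3) := by gcongr
        _ = 2 ^ (d + (b + (d + 8 * b * d ^ 4)) + 14 * b * d ^ 3) * (2 ^ (26 * b * d ^ 4))⁻¹ := by
          simp only [pow_add]; ring
        _ < 1 := by
          rw [← div_eq_mul_inv, div_lt_one (by positivity)]
          exact hlt
    exact lt_irrefl _ this
end

section
/- Let λ < 0 be a real number, k ≥ 1 an integer, and C ≥ ε > 0 real numbers with kC > ε. Let x₁,…,x_k ∈ ℝ satisfy |xᵢ| ≤ C for all i. For 1 ≤ j ≤ k define x_j(t) = exp(λt) · Σ_{i=j}^{k} xᵢ · t^{i-j}/(i-j)!. Set a = max(1, k/(-λ)). Then for every t ≥ max(1, 4a·log(2a) + (2/(-λ))·log(kC/ε)) and every j with 1 ≤ j ≤ k, one has |x_j(t)| ≤ ε. -/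
open Finset in
/-- **Escape-time bound for a negative-eigenvalue Jordan block.**
For a `k×k` Jordan block with eigenvalue `λ < 0` and initial data bounded by `C`,
after time `max(1, 4a·log(2a) + (2/(-λ))·log(kC/ε))` with `a = max(1, k/(-λ))`,
every component of the trajectory has absolute value at most `ε`. -/
theorem jordan_block_neg_eigenvalue_escape (lam : ℝ) (hlam : lam < 0)
    (k : ℕ) (hk : 1 ≤ k) (C ε : ℝ) (hε : 0 < ε) (hεC : ε ≤ C) (hkC : ε < k * C)
    (x : ℕ → ℝ) (hx : ∀ i, 1 ≤ i → i ≤ k → |x i| ≤ C)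
    (a : ℝ) (ha : a = max 1 (k / (-lam)))
    (t : ℝ) (ht : max 1 (4 * a * Real.log (2 * a) + 2 / (-lam) * Real.log (k * C / ε)) ≤ t)
    (j : ℕ) (hj1 : 1 ≤ j) (hjk : j ≤ k) :
    |Real.exp (lam * t) *
        ∑ i ∈ Icc j k, x i * t ^ (i - j) / (Nat.factorial (i - j) : ℝ)| ≤ ε := by
  have hm : 0 < -lam := by linarith
  have ht1 : 1 ≤ t := le_trans (le_max_left _ _) ht
  have ht2 := le_trans (le_max_right _ _) ht
  have ha1 : 1 ≤ a := ha ▸ le_max_left _ _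
  have hak : k / (-lam) ≤ a := ha ▸ le_max_right _ _
  have ht0 : 0 < t := by linarith
  have ha0 : 0 < a := by linarith
  have hC : 0 < C := by linarith
  have hq : 1 < k * C / ε := by rwa [one_lt_div hε]
  have hL : 0 < Real.log (k * C / ε) := Real.log_pos hq
  set L := Real.log (k * C / ε) with hLdef
  have hlt : 0 ≤ Real.log t := Real.log_nonneg ht1
  have hla : 0 ≤ Real.log (2 * a) := Real.log_nonneg (by linarith)
  have hal : 0 ≤ 4 * a * Real.log (2 * a) := by positivity
  have hLm : 0 < 2 / (-lam) * L := by positivity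
  -- the elementary logarithm estimate
  have h1 : 2 * a * Real.log t ≤ t := by
    have e1 : Real.log (t / (4 * a)) ≤ t / (4 * a) - 1 :=
      Real.log_le_sub_one_of_pos (by positivity)
    have e2 : Real.log (t / (4 * a)) = Real.log t - (Real.log 2 + Real.log (2 * a)) := by
      rw [Real.log_div (by positivity) (by positivity),
        ← Real.log_mul (by positivity) (by positivity)]
      congr 2
      ring
    have e3 : Real.log 2 ≤ 1 := by
      have := Real.log_le_sub_one_of_pos (show (0:ℝ) < 2 by norm_num)
      linarith
    have e4 : Real.log t ≤ t / (4 * a) + Real.log (2 * a) := by linarith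
    have e5 : 2 * a * Real.log t ≤ 2 * a * (t / (4 * a) + Real.log (2 * a)) := by gcongr
    have e6 : 2 * a * (t / (4 * a) + Real.log (2 * a)) = t / 2 + 2 * a * Real.log (2 * a) := by
      field_simp
      ring
    linarith
  have h2 : k / (-lam) * Real.log t ≤ a * Real.log t := by gcongr
  have h3 : k / (-lam) * Real.log t + 1 / (-lam) * L ≤ t := by
    have : 2 / (-lam) * L = 2 * (1 / (-lam) * L) := by ring
    linarith
  have h4 : k * Real.log t + L ≤ -lam * t := by
    have := mul_le_mul_of_nonneg_left h3 hm.le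
    have e : -lam * (k / (-lam) * Real.log t + 1 / (-lam) * L) = k * Real.log t + L := by
      have hne := hlam.ne
      field_simp
      ring
    linarith
  have hsum : |∑ i ∈ Icc j k, x i * t ^ (i - j) / (Nat.factorial (i - j) : ℝ)|
      ≤ k * C * t ^ k := by
    refine (abs_sum_le_sum_abs _ _).trans ?_
    have hterm : ∀ i ∈ Icc j k,
        |x i * t ^ (i - j) / (Nat.factorial (i - j) : ℝ)| ≤ C * t ^ k := by
      intro i hi
      rw [mem_Icc] at hi
      have hf : (1:ℝ) ≤ (Nat.factorial (i - j) : ℝ) := by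
        exact_mod_cast Nat.succ_le_of_lt (Nat.factorial_pos _)
      rw [abs_div, abs_mul, abs_of_pos (pow_pos ht0 _), abs_of_pos (by linarith : (0:ℝ) < (Nat.factorial (i - j) : ℝ))]
      refine (div_le_self (by positivity) hf).trans ?_
      have := hx i (by omega) hi.2
      have hp : t ^ (i - j) ≤ t ^ k := pow_le_pow_right₀ ht1 (by omega)
      gcongr
    refine (sum_le_card_nsmul _ _ _ hterm).trans ?_
    rw [nsmul_eq_mul, Nat.card_Icc, mul_assoc]
    have : ((k + 1 - j : ℕ) : ℝ) ≤ k := by exact_mod_cast (by omega : k + 1 - j ≤ k)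
    gcongr
  rw [abs_mul, abs_of_pos (Real.exp_pos _)]
  have e1 : (k * C * t ^ k : ℝ) = ε * Real.exp (k * Real.log t + L) := by
    rw [Real.exp_add, hLdef, Real.exp_log (by linarith), Real.exp_nat_mul, Real.exp_log ht0]
    field_simp
  calc _ ≤ Real.exp (lam * t) * (k * C * t ^ k) := by gcongr
    _ = ε * Real.exp (lam * t + (k * Real.log t + L)) := by
      rw [e1, Real.exp_add (lam * t)]
      ring
    _ ≤ ε * 1 := by
      gcongr
      rw [Real.exp_le_one_iff]
      linarith
    _ = ε := mul_one _
end

section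
/- Let k ≥ 2 be an integer and C ≥ ε > 0 real numbers. Let x₁,…,x_k ∈ ℝ satisfy |xᵢ| ≤ C for all i, and suppose there exists an index j₀ with 2 ≤ j₀ ≤ k and |x_{j₀}| > ε. For 1 ≤ j ≤ k define x_j(t) = Σ_{i=j}^{k} xᵢ · t^{i-j}/(i-j)!. Then there exist a time t with 0 ≤ t ≤ (1/k)·(k²C/ε)^{2^{k-1}} and an index j with 1 ≤ j ≤ k such that |x_j(t)| > C. -/
open Polynomial in
/-- Endpoint Markov inequality on `[0,T]`, one-sided. -/
lemma endpoint_markov (n : ℕ) (hn : 1 ≤ n) (P : ℝ[X]) (hP : P.natDegree ≤ n) (C T : ℝ)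
    (hC : 0 < C) (hT : 0 < T) (hb : ∀ t, 0 ≤ t → t ≤ T → |P.eval t| ≤ C) (s : ℝ) (hs : |s| = 1) :
    s * P.derivative.eval 0 * T ≤ 2 * C * n ^ 2 := by
  set L : ℝ[X] := Polynomial.C (T / 2) - Polynomial.C (T / 2) * X with hL
  set Q : ℝ[X] := Polynomial.C (-s / C) * P.comp L with hQ
  have hLd : L.natDegree ≤ 1 := by
    rw [hL]; compute_degree
  have hQd : Q.degree ≤ n := by
    apply Polynomial.degree_le_of_natDegree_le
    refine (Polynomial.natDegree_C_mul_le _ _).trans ?_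
    rw [Polynomial.natDegree_comp]
    nlinarith
  have hQb : ∀ x ∈ Set.Icc (-1 : ℝ) 1, |Q.eval x| ≤ 1 := by
    intro x hx
    have h := hb (T / 2 - T / 2 * x) (by nlinarith [hx.1, hx.2]) (by nlinarith [hx.1, hx.2])
    simp only [hQ, hL, eval_mul, eval_C, eval_comp, eval_sub, eval_X, abs_mul, abs_div, abs_neg, hs,
      abs_of_pos hC]
    rw [one_div, inv_mul_le_iff₀ hC]
    linarith
  have key := Polynomial.Chebyshev.eval_iterate_derivative_le_of_forall_abs_le_one
    (n := n) (k := 1) (x := 1) le_rfl hQd hQb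
  have hT1 := Polynomial.Chebyshev.derivative_T_eval_one (R := ℝ) n
  simp only [Function.iterate_one] at key
  rw [hT1] at key
  have : Q.derivative.eval 1 = s * P.derivative.eval 0 * T / (2 * C) := by
    simp [hQ, hL, derivative_comp]
    field_simp
  rw [this, div_le_iff₀ (by positivity)] at key
  push_cast at key
  linarith

open Finset in
/-- **Escape-time bound for a zero-eigenvalue Jordan block.**
For a `k×k` Jordan block with eigenvalue `0`, initial data bounded by `C`, and some
component `x_{j₀}` with `j₀ ≥ 2` exceeding `ε` in absolute value, some component of the
trajectory exceeds `C` in absolute value within time `(1/k)·(k²C/ε)^(2^(k-1))`. -/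
theorem jordan_block_zero_eigenvalue_escape (k : ℕ) (hk : 2 ≤ k)
    (C ε : ℝ) (hε : 0 < ε) (hεC : ε ≤ C)
    (x : ℕ → ℝ) (hx : ∀ i, 1 ≤ i → i ≤ k → |x i| ≤ C)
    (hbig : ∃ j₀, 2 ≤ j₀ ∧ j₀ ≤ k ∧ ε < |x j₀|) :
    ∃ t : ℝ, 0 ≤ t ∧ t ≤ (1 / k) * (k ^ 2 * C / ε) ^ 2 ^ (k - 1) ∧
      ∃ j, 1 ≤ j ∧ j ≤ k ∧
        C < |∑ i ∈ Icc j k, x i * t ^ (i - j) / (Nat.factorial (i - j) : ℝ)| := by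
  by_contra! hcon
  obtain ⟨j₀, h2, hjk, hj⟩ := hbig
  obtain ⟨j, rfl⟩ : ∃ j, j₀ = j + 1 := ⟨j₀ - 1, by omega⟩
  have hC : 0 < C := hε.trans_le hεC
  have hk2 : (2 : ℝ) ≤ k := by exact_mod_cast hk
  set T : ℝ := (1 / k) * (k ^ 2 * C / ε) ^ 2 ^ (k - 1) with hTdef
  have hT : 0 < T := by positivity
  have hA : (k : ℝ) ^ 2 ≤ k ^ 2 * C / ε := by
    rw [le_div_iff₀ hε]
    gcongr
  have hTlow : (k : ℝ) ^ 3 * C ≤ ε * T := by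
    have h1 : (k ^ 2 * C / ε) ^ 2 ≤ (k ^ 2 * C / ε) ^ 2 ^ (k - 1) := by
      apply pow_le_pow_right₀ (by nlinarith)
      calc 2 = 2 ^ 1 := rfl
        _ ≤ 2 ^ (k - 1) := Nat.pow_le_pow_right (by norm_num) (by omega)
    have h3 : (k : ℝ) ^ 2 * (k ^ 2 * C / ε) ≤ (k ^ 2 * C / ε) ^ 2 := by
      rw [sq (k ^ 2 * C / ε)]
      gcongr
    calc (k : ℝ) ^ 3 * C = ε * (1 / k * (k ^ 2 * (k ^ 2 * C / ε))) := by field_simp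
      _ ≤ ε * T := by
        rw [hTdef]
        gcongr
        exact h3.trans h1
  set P : Polynomial ℝ := ∑ i ∈ Icc j k,
    Polynomial.monomial (i - j) (x i / (Nat.factorial (i - j) : ℝ)) with hP
  have hPd : P.natDegree ≤ k - 1 := by
    apply Polynomial.natDegree_sum_le_of_forall_le
    intro i hi
    rw [mem_Icc] at hi
    exact (Polynomial.natDegree_monomial_le _).trans (by omega)
  have hPb : ∀ t, 0 ≤ t → t ≤ T → |P.eval t| ≤ C := by
    intro t h0 h1
    refine le_of_eq_of_le (congrArg abs ?_) (hcon t h0 h1 j (by omega) (by omega))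
    rw [hP, Polynomial.eval_finset_sum]
    refine sum_congr rfl fun i _ => ?_
    rw [Polynomial.eval_monomial]
    ring
  have hP0 : P.derivative.eval 0 = x (j + 1) := by
    rw [← Polynomial.coeff_zero_eq_eval_zero, Polynomial.coeff_derivative, hP,
      Polynomial.finsetSum_coeff, sum_eq_single (j + 1)]
    · simp
    · intro i hi hne
      rw [mem_Icc] at hi
      rw [Polynomial.coeff_monomial, if_neg (by omega)]
    · intro h
      exact absurd (mem_Icc.2 ⟨by omega, hjk⟩) h
  have hm := endpoint_markov (k - 1) (by omega) P hPd C T hC hT hPb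
  rw [hP0] at hm
  have hcast : ((k - 1 : ℕ) : ℝ) = k - 1 := by
    rw [Nat.cast_sub (by omega)]; simp
  rw [hcast] at hm
  have hm1 := hm 1 (by simp)
  have hm2 := hm (-1) (by simp)
  have habs : |x (j + 1)| * T ≤ 2 * C * ((k : ℝ) - 1) ^ 2 := by
    rcases abs_cases (x (j + 1)) with h | h <;> rw [h.1] <;> linarith
  have hlt : ε * T < |x (j + 1)| * T := by gcongr
  have hfin : 2 * ((k : ℝ) - 1) ^ 2 ≤ k ^ 3 := by nlinarith [sq_nonneg ((k : ℝ))]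
  nlinarith
end

section
/- Let λ > 0 be a real number, k ≥ 1 an integer, and C ≥ ε > 0 real numbers satisfying log(kC/ε) > 4k·log(2k/λ). Let x₁,…,x_k ∈ ℝ satisfy |xᵢ| ≤ C for all i, and suppose there exists an index j₀ with 1 ≤ j₀ ≤ k and |x_{j₀}| > ε. For 1 ≤ j ≤ k define x_j(t) = exp(λt) · Σ_{i=j}^{k} xᵢ · t^{i-j}/(i-j)!. Then there exist a time t with 0 ≤ t ≤ (2^{k-1}/λ)·log(kC/ε) and an index j with 1 ≤ j ≤ k such that |x_j(t)| > C. -/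
lemma jb_inner (T : ℝ) (n : ℕ) :
    ∑ m ∈ Finset.range (n + 1), T ^ (n - m) / ((n - m).factorial : ℝ) *
      ((-T) ^ m / (m.factorial : ℝ)) = if n = 0 then 1 else 0 := by
  have h := add_pow (-T) T n
  have hn : (n.factorial : ℝ) ≠ 0 := by positivity
  have h2 : ∑ m ∈ Finset.range (n + 1), T ^ (n - m) / ((n - m).factorial : ℝ) *
      ((-T) ^ m / (m.factorial : ℝ)) = (-T + T) ^ n / n.factorial := by
    rw [h, Finset.sum_div]
    apply Finset.sum_congr rfl
    intro m hm
    have hm' : m ≤ n := by simpa [Nat.lt_succ_iff] using hm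
    have hc : (n.choose m : ℝ) * m.factorial * (n - m).factorial = n.factorial := by
      exact_mod_cast Nat.choose_mul_factorial_mul_factorial hm'
    have h1 : (m.factorial : ℝ) ≠ 0 := by positivity
    have h3 : ((n - m).factorial : ℝ) ≠ 0 := by positivity
    rw [← hc] at hn ⊢
    have h4 : (n.choose m : ℝ) ≠ 0 := by
      intro h0; simp [h0] at hn
    field_simp
  rw [h2]
  rcases n with _ | n <;> simp

lemma jb_inv (x : ℕ → ℝ) (T : ℝ) (j k : ℕ) (hjk : j ≤ k) :
    ∑ i ∈ Finset.Icc j k, (∑ l ∈ Finset.Icc i k, x l * T ^ (l - i) / ((l - i).factorial : ℝ)) *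
      ((-T) ^ (i - j) / ((i - j).factorial : ℝ)) = x j := by
  simp_rw [Finset.sum_mul]
  rw [Finset.sum_comm' (t' := Finset.Icc j k) (s' := fun l => Finset.Icc j l)
    (by intro a b; simp only [Finset.mem_Icc]; omega)]
  have key : ∀ l ∈ Finset.Icc j k, ∑ i ∈ Finset.Icc j l, x l * T ^ (l - i) / ((l - i).factorial : ℝ) *
      ((-T) ^ (i - j) / ((i - j).factorial : ℝ)) = if l = j then x l else 0 := by
    intro l hl
    have hl' := Finset.mem_Icc.1 hl
    have h := jb_inner T (l - j)
    have e : Finset.Icc j l = Finset.Ico j (l + 1) := by ext; simp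
    rw [e, Finset.sum_Ico_eq_sum_range, show l + 1 - j = l - j + 1 by omega]
    have : (if l = j then x l else 0) = x l * (if l - j = 0 then 1 else 0) := by
      by_cases hlj : l = j
      · simp [hlj]
      · rw [if_neg hlj, if_neg (by omega)]; simp
    rw [this, ← h, Finset.mul_sum]
    apply Finset.sum_congr rfl
    intro m _
    rw [show l - (j + m) = l - j - m by omega, show j + m - j = m by omega]
    ring
  rw [Finset.sum_congr rfl key]
  simp [hjk]

lemma jb_bound (lam : ℝ) (hlam : 0 < lam) (k : ℕ) (hk : 1 ≤ k) (L T : ℝ) (hL : 0 ≤ L)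
    (hlog : 4 * k * Real.log (2 * k / lam) < L) (hT : T = 2 ^ (k - 1) / lam * L) :
    Real.exp L * (max 1 T) ^ (k - 1) ≤ Real.exp (lam * T) := by
  have hlT : lam * T = 2 ^ (k - 1) * L := by rw [hT]; field_simp
  have hk0 : (1 : ℝ) ≤ k := by exact_mod_cast hk
  have hP : (k : ℝ) ≤ 2 ^ (k - 1) := by
    have : k ≤ 2 ^ (k - 1) := by
      have := @Nat.lt_two_pow_self (k - 1); omega
    exact_mod_cast this
  rw [hlT]
  rcases le_total T 1 with h | h
  · rw [max_eq_left h, one_pow, mul_one]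
    apply Real.exp_le_exp.2
    nlinarith
  · rw [max_eq_right h]
    have hT0 : 0 < T := by linarith
    have hL0 : 0 < L := by
      rcases hL.lt_or_eq with h' | h'
      · exact h'
      · rw [← h'] at hT; simp at hT; linarith
    generalize hPd : (2 : ℝ) ^ (k - 1) = P at *
    have hlT' : Real.log T ≤ P * L / (2 * k) + L / (4 * k) := by
      have e : T = (P * L / (2 * k)) * (2 * k / lam) := by rw [hT]; field_simp
      have hp : 0 < P * L / (2 * k) := by
        have : 0 < P := by linarith
        positivity
      rw [e, Real.log_mul hp.ne' (by positivity)]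
      have h1 := Real.log_le_sub_one_of_pos hp
      have h2 : Real.log (2 * k / lam) ≤ L / (4 * k) := by
        rw [le_div_iff₀ (by positivity)]; linarith
      linarith
    have e1 : T ^ (k - 1) = Real.exp ((k - 1 : ℝ) * Real.log T) := by
      rw [mul_comm, Real.exp_mul, Real.exp_log hT0, ← Real.rpow_natCast]
      push_cast [hk]; rfl
    rw [e1, ← Real.exp_add]
    apply Real.exp_le_exp.2
    have h3 : (k - 1 : ℝ) * Real.log T ≤ (k - 1 : ℝ) * (P * L / (2 * k) + L / (4 * k)) :=
      mul_le_mul_of_nonneg_left hlT' (by linarith)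
    have h4 : (k - 1 : ℝ) * (P * L / (2 * k) + L / (4 * k)) ≤ (P - 1) * L := by
      have : (k - 1 : ℝ) * (P * L / (2 * k) + L / (4 * k)) = ((k - 1) * (2 * P + 1)) * L / (4 * k) := by
        field_simp
        ring
      rw [this, div_le_iff₀ (by positivity)]
      have h5 : (k - 1 : ℝ) * (2 * P + 1) ≤ (P - 1) * (4 * k) := by nlinarith
      nlinarith
    linarith

open Finset in
/-- **Escape-time bound for a positive-eigenvalue Jordan block.**
For a `k×k` Jordan block with eigenvalue `λ > 0`, initial data bounded by `C`, and some
component `x_{j₀}` exceeding `ε` in absolute value, some component of the trajectory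
exceeds `C` in absolute value within time `(2^(k-1)/λ)·log(kC/ε)`,
provided `log(kC/ε) > 4k·log(2k/λ)`. -/
theorem jordan_block_pos_eigenvalue_escape (lam : ℝ) (hlam : 0 < lam)
    (k : ℕ) (hk : 1 ≤ k) (C ε : ℝ) (hε : 0 < ε) (hεC : ε ≤ C)
    (hlog : 4 * k * Real.log (2 * k / lam) < Real.log (k * C / ε))
    (x : ℕ → ℝ) (hx : ∀ i, 1 ≤ i → i ≤ k → |x i| ≤ C)
    (hbig : ∃ j₀, 1 ≤ j₀ ∧ j₀ ≤ k ∧ ε < |x j₀|) :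
    ∃ t : ℝ, 0 ≤ t ∧ t ≤ 2 ^ (k - 1) / lam * Real.log (k * C / ε) ∧
      ∃ j, 1 ≤ j ∧ j ≤ k ∧
        C < |Real.exp (lam * t) *
              ∑ i ∈ Icc j k, x i * t ^ (i - j) / (Nat.factorial (i - j) : ℝ)| := by
  obtain ⟨j₀, hj1, hjk, hj⟩ := hbig
  by_contra! hcon
  have hk0 : (1 : ℝ) ≤ k := by exact_mod_cast hk
  have hC : 0 < C := by linarith
  have hge : 1 ≤ k * C / ε := by
    rw [le_div_iff₀ hε]; nlinarith
  have hL : 0 ≤ Real.log (k * C / ε) := Real.log_nonneg hge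
  obtain ⟨T, hT⟩ : ∃ T : ℝ, T = 2 ^ (k - 1) / lam * Real.log (k * C / ε) := ⟨_, rfl⟩
  have hT0 : 0 ≤ T := by rw [hT]; positivity
  have hb := jb_bound lam hlam k hk _ T hL hlog hT
  rw [Real.exp_log (by linarith)] at hb
  have hc := hcon T hT0 hT.le
  have hinv := jb_inv x T j₀ k hjk
  have hE := Real.exp_pos (lam * T)
  have hM : (1 : ℝ) ≤ max 1 T := le_max_left _ _
  have hterm : ∀ i ∈ Icc j₀ k,
      |(∑ l ∈ Icc i k, x l * T ^ (l - i) / ((l - i).factorial : ℝ)) *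
      ((-T) ^ (i - j₀) / ((i - j₀).factorial : ℝ))| ≤
        C / Real.exp (lam * T) * (max 1 T) ^ (k - 1) := by
    intro i hi
    have hi' := mem_Icc.1 hi
    rw [abs_mul]
    apply mul_le_mul _ _ (abs_nonneg _) (by positivity)
    · have := hc i (by omega) hi'.2
      rw [abs_mul, abs_of_pos hE] at this
      rw [le_div_iff₀ hE]; linarith
    · rw [abs_div, abs_pow, abs_neg, abs_of_nonneg hT0, Nat.abs_cast]
      calc T ^ (i - j₀) / ((i - j₀).factorial : ℝ) ≤ T ^ (i - j₀) :=
            div_le_self (by positivity) (by exact_mod_cast Nat.factorial_pos _)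
        _ ≤ (max 1 T) ^ (i - j₀) := pow_le_pow_left₀ hT0 (le_max_right _ _) _
        _ ≤ (max 1 T) ^ (k - 1) := pow_le_pow_right₀ hM (by omega)
  have hsum := (abs_sum_le_sum_abs _ _).trans (sum_le_card_nsmul _ _ _ hterm)
  rw [hinv, nsmul_eq_mul] at hsum
  have hcard : ((#(Icc j₀ k) : ℕ) : ℝ) ≤ k := by
    rw [Nat.card_Icc]; exact_mod_cast (by omega : k + 1 - j₀ ≤ k)
  have h1 : (#(Icc j₀ k) : ℝ) * (C / Real.exp (lam * T) * (max 1 T) ^ (k - 1)) ≤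
      k * (C / Real.exp (lam * T) * (max 1 T) ^ (k - 1)) :=
    mul_le_mul_of_nonneg_right hcard (by positivity)
  have h2 : k * (C / Real.exp (lam * T) * (max 1 T) ^ (k - 1)) ≤ ε := by
    have e : k * (C / Real.exp (lam * T) * (max 1 T) ^ (k - 1)) =
      (k * C / ε * (max 1 T) ^ (k - 1)) * ε / Real.exp (lam * T) := by field_simp
    rw [e, div_le_iff₀ hE]
    nlinarith
  linarith
end

section
/- Let A be a d×d real matrix and let v ∈ ℝᵈ lie in the sum of the generalized eigenspaces of A associated with (real) negative eigenvalues, i.e., v ∈ Σ_{λ < 0} ker((A − λI)ᵈ). Let N = Σ_{λ < 0 eigenvalue of A} ν(λ), where ν(λ) is the multiplicity of λ as a root of the minimal polynomial of A. Then the origin 0 lies in the convex hull of the finite set {v, Av, A²v, …, A^N v}. -/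
open Polynomial in
theorem coeff_nonneg_mul_aux (f g : ℝ[X]) (hf : ∀ n, 0 ≤ f.coeff n) (hg : ∀ n, 0 ≤ g.coeff n) :
    ∀ n, 0 ≤ (f * g).coeff n := by
  intro n
  rw [coeff_mul]
  exact Finset.sum_nonneg fun i _ => mul_nonneg (hf _) (hg _)

open Polynomial in
theorem coeff_nonneg_one_aux : ∀ n, 0 ≤ (1 : ℝ[X]).coeff n := by
  intro n
  rw [coeff_one]
  split_ifs <;> norm_num

open Polynomial in
theorem coeff_nonneg_pow_aux (a : ℝ) (ha : a < 0) (k : ℕ) :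
    ∀ n, 0 ≤ ((X - C a) ^ k).coeff n := by
  induction k with
  | zero => simpa using coeff_nonneg_one_aux
  | succ k ih =>
    rw [pow_succ]
    refine coeff_nonneg_mul_aux _ _ ih ?_
    intro n
    rw [coeff_sub, coeff_X, coeff_C]
    split_ifs <;> first | linarith | omega

open Polynomial in
theorem aeval_pow_kill_aux (d : ℕ) (A : Matrix (Fin d) (Fin d) ℝ) (a : ℝ) (w : Fin d → ℝ)
    (hw : ((A - a • 1) ^ d).mulVec w = 0) (p : ℝ[X])
    (hp : (X - C a) ^ (rootMultiplicity a (minpoly ℝ A)) ∣ p) :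
    (aeval A p).mulVec w = 0 := by
  have hint : IsIntegral ℝ A := Matrix.isIntegral A
  obtain ⟨q, hq, hnd⟩ := exists_eq_pow_rootMultiplicity_mul_and_not_dvd
    (minpoly ℝ A) (minpoly.ne_zero hint) a
  obtain ⟨r, rfl⟩ := hp
  have hcop : IsCoprime ((X - C a) ^ d) q :=
    IsCoprime.pow_left (((irreducible_X_sub_C a).coprime_iff_not_dvd).2 hnd)
  obtain ⟨s, t, hst⟩ := hcop
  set k := rootMultiplicity a (minpoly ℝ A)
  have e : (X - C a) ^ k * r = (r * (X - C a) ^ k * s) * (X - C a) ^ d + (r * t) * minpoly ℝ A := by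
    calc (X - C a) ^ k * r = (X - C a) ^ k * r * (s * (X - C a) ^ d + t * q) := by
          rw [hst, mul_one]
      _ = (r * (X - C a) ^ k * s) * (X - C a) ^ d + (r * t) * ((X - C a) ^ k * q) := by ring
      _ = _ := by rw [← hq]
  have h1 : aeval A ((X - C a) ^ d) = (A - a • 1) ^ d := by
    simp [Algebra.algebraMap_eq_smul_one]
  rw [e, map_add, map_mul, map_mul _ (r * t), minpoly.aeval, mul_zero, add_zero, h1,
    ← Matrix.mulVec_mulVec, hw, Matrix.mulVec_zero]

open Polynomial in
/-- **Zero in convex hull (discrete case).**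
If `v` lies in the sum of the generalized eigenspaces of `A` for negative real
eigenvalues, and `N` is the sum of the multiplicities of the negative eigenvalues
as roots of the minimal polynomial of `A`, then the origin lies in the convex hull
of `{v, Av, …, A^N v}`. -/
theorem zero_mem_convexHull_orbit_of_neg_eigenspaces (d : ℕ)
    (A : Matrix (Fin d) (Fin d) ℝ) (v : Fin d → ℝ)
    (hv : v ∈ ⨆ lam ∈ Set.Iio (0 : ℝ),
      LinearMap.ker (Matrix.mulVecLin ((A - lam • 1) ^ d)))
    (N : ℕ)
    (hN : N = ∑ lam ∈ ((minpoly ℝ A).roots.toFinset.filter fun lam => lam < 0),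
      rootMultiplicity lam (minpoly ℝ A)) :
    (0 : Fin d → ℝ) ∈ convexHull ℝ ((fun m : ℕ => (A ^ m).mulVec v) '' {m | m ≤ N}) := by
  classical
  set S := (minpoly ℝ A).roots.toFinset.filter fun lam => lam < 0 with hS
  set p : ℝ[X] := ∏ a ∈ S, (X - C a) ^ rootMultiplicity a (minpoly ℝ A) with hp
  have hmon : p.Monic := monic_prod_of_monic _ _ fun a _ => (monic_X_sub_C a).pow _
  have hdeg : p.natDegree = N := by
    rw [hp, natDegree_prod_of_monic _ _ fun a _ => (monic_X_sub_C a).pow _, hN]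
    simp
  have hnn : ∀ n, 0 ≤ p.coeff n := by
    refine Finset.prod_induction _ (fun f : ℝ[X] => ∀ n, 0 ≤ f.coeff n)
      coeff_nonneg_mul_aux coeff_nonneg_one_aux ?_
    intro a ha
    exact coeff_nonneg_pow_aux a (Finset.mem_filter.1 ha).2 _
  have hkill : (aeval A p).mulVec v = 0 := by
    have hle : (⨆ lam ∈ Set.Iio (0 : ℝ), LinearMap.ker (Matrix.mulVecLin ((A - lam • 1) ^ d)))
        ≤ LinearMap.ker (Matrix.mulVecLin (aeval A p)) := by
      refine iSup₂_le fun a ha w hw => ?_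
      rw [LinearMap.mem_ker, Matrix.mulVecLin_apply] at hw ⊢
      refine aeval_pow_kill_aux d A a w hw p ?_
      by_cases haS : a ∈ S
      · exact Finset.dvd_prod_of_mem
          (fun a => (X - C a) ^ rootMultiplicity a (minpoly ℝ A)) haS
      · have : rootMultiplicity a (minpoly ℝ A) = 0 := by
          rw [← count_roots, Multiset.count_eq_zero]
          intro h
          exact haS (Finset.mem_filter.2 ⟨Multiset.mem_toFinset.2 h, ha⟩)
        rw [this, pow_zero]
        exact one_dvd _
    have := hle hv
    rwa [LinearMap.mem_ker, Matrix.mulVecLin_apply] at this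
  have hsum : ∑ i ∈ Finset.range (N + 1), p.coeff i • (A ^ i).mulVec v = 0 := by
    rw [aeval_eq_sum_range, hdeg, Matrix.sum_mulVec] at hkill
    simpa [Matrix.smul_mulVec] using hkill
  have hpos : 0 < ∑ i ∈ Finset.range (N + 1), p.coeff i := by
    refine Finset.sum_pos' (fun i _ => hnn i) ⟨N, by simp, ?_⟩
    rw [← hdeg, hmon.coeff_natDegree]
    exact one_pos
  have := Finset.centerMass_mem_convexHull (R := ℝ) (Finset.range (N + 1))
    (w := fun i => p.coeff i) (z := fun m : ℕ => (A ^ m).mulVec v)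
    (s := (fun m : ℕ => (A ^ m).mulVec v) '' {m | m ≤ N})
    (fun i _ => hnn i) hpos
    (fun i hi => ⟨i, Nat.lt_succ_iff.1 (Finset.mem_range.1 hi), rfl⟩)
  rwa [Finset.centerMass, hsum, smul_zero] at this
end

section
/- Let d ≥ 4 and b ≥ 1 be natural numbers and let A be a d×d matrix with rational entries of bit size at most b. Then every complex eigenvalue λ of A with Im(λ) ≠ 0 satisfies |Im(λ)| ≥ 4^{-3bd³}. -/
open Polynomial in
lemma trailing_lin (a : ℂ) : (X - C a : ℂ[X]).trailingCoeff = if a = 0 then 1 else -a := by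
  split_ifs with h
  · subst h; simp [Polynomial.trailingCoeff]
  · have : (X - C a : ℂ[X]).natTrailingDegree = 0 := by
      rw [Polynomial.natTrailingDegree_eq_zero]
      right; simpa using h
    simp [Polynomial.trailingCoeff, this]

open Polynomial in
lemma trailing_prod (S : ℝ) (hS : 1 ≤ S) (s : Multiset ℂ) (hs : ∀ a ∈ s, ‖a‖ ≤ S) :
    ‖((s.map (fun a => X - C a)).prod).trailingCoeff‖ ≤ S ^ (Multiset.card s) := by
  induction s using Multiset.induction_on with
  | empty => simp [Polynomial.trailingCoeff]
  | cons a s ih =>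
    rw [Multiset.map_cons, Multiset.prod_cons, Polynomial.trailingCoeff_mul, norm_mul,
      Multiset.card_cons, pow_succ, mul_comm]
    have h1 := ih (fun x hx => hs x (Multiset.mem_cons_of_mem hx))
    have h2 : ‖(X - C a : ℂ[X]).trailingCoeff‖ ≤ S := by
      rw [trailing_lin]
      split_ifs
      · simpa using hS
      · simpa using hs a (Multiset.mem_cons_self a s)
    gcongr

open Polynomial in
lemma root_lower (F : ℤ[X]) (c : ℂ) (hc : c ≠ 0) (s : Multiset ℂ) (S : ℝ) (hS : 1 ≤ S)
    (hs : ∀ a ∈ s, ‖a‖ ≤ S)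
    (hF : F.map (Int.castRingHom ℂ) = C c * (s.map (fun a => X - C a)).prod)
    (δ : ℂ) (hδ : δ ∈ s) (h0 : δ ≠ 0) : 1 ≤ ‖c‖ * (‖δ‖ * S ^ (Multiset.card s)) := by
  have hne : F.map (Int.castRingHom ℂ) ≠ 0 := by
    rw [hF]
    refine mul_ne_zero (by simpa using hc) ?_
    exact (Polynomial.monic_multiset_prod_of_monic s _ (fun a _ => monic_X_sub_C a)).ne_zero
  have h1 : 1 ≤ ‖(F.map (Int.castRingHom ℂ)).trailingCoeff‖ := by
    have h2 : (F.map (Int.castRingHom ℂ)).trailingCoeff ≠ 0 := by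
      simpa [Polynomial.trailingCoeff_eq_zero] using hne
    rw [Polynomial.trailingCoeff, Polynomial.coeff_map] at h2 ⊢
    set z := F.coeff (F.map (Int.castRingHom ℂ)).natTrailingDegree
    have hz : z ≠ 0 := by rintro h; simp [h] at h2
    have : (1 : ℝ) ≤ |(z : ℝ)| := by exact_mod_cast Int.one_le_abs hz
    simpa using this
  refine h1.trans ?_
  obtain ⟨t, rfl⟩ := Multiset.exists_cons_of_mem hδ
  have h3 := trailing_prod S hS t (fun x hx => hs x (Multiset.mem_cons_of_mem hx))
  rw [hF, Polynomial.trailingCoeff_mul, Multiset.map_cons, Multiset.prod_cons,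
    Polynomial.trailingCoeff_mul, trailing_lin, if_neg h0, norm_mul, norm_mul, norm_neg]
  have hC : (C c : ℂ[X]).trailingCoeff = c := by simp [Polynomial.trailingCoeff]
  rw [hC]
  have h4 : S ^ (Multiset.card t) ≤ S ^ (Multiset.card (δ ::ₘ t)) :=
    pow_le_pow_right₀ hS (by simp)
  have h5 := h3.trans h4
  gcongr

open Polynomial in
lemma int_charpoly {n : Type*} [Fintype n] [DecidableEq n] (K : Matrix n n ℂ) (r : n → ℤ)
    (z : n → n → ℤ) (h : ∀ i j, (r i : ℂ) * K i j = z i j) :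
    ∃ F : ℤ[X], F.map (Int.castRingHom ℂ) = C ((∏ i, r i : ℤ) : ℂ) * K.charpoly := by
  refine ⟨(Matrix.of fun i j => C (r i) * (if i = j then X else 0) - C (z i j)).det, ?_⟩
  rw [← Polynomial.coe_mapRingHom, RingHom.map_det]
  have : (C ((∏ i, r i : ℤ) : ℂ) : ℂ[X]) = ∏ i, C (r i : ℂ) := by simp [map_prod]
  rw [this, Matrix.charpoly, ← Matrix.det_mul_column]
  congr 1
  ext1 i j
  simp only [RingHom.mapMatrix_apply, Matrix.map_apply, Matrix.of_apply, Matrix.charmatrix_apply,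
    Polynomial.coe_mapRingHom, Polynomial.map_sub, Polynomial.map_mul, Polynomial.map_C, mul_sub,
    ← C_mul, h, Matrix.diagonal_apply]
  split_ifs <;> simp

lemma root_iff {n : Type*} [Fintype n] [DecidableEq n] (K : Matrix n n ℂ) (μ : ℂ) :
    K.charpoly.IsRoot μ ↔ ∃ v, v ≠ 0 ∧ K.mulVec v = μ • v := by
  rw [Polynomial.IsRoot, Matrix.eval_charpoly, ← Matrix.exists_mulVec_eq_zero_iff]
  refine exists_congr fun v => and_congr_right fun _ => ?_
  rw [Matrix.sub_mulVec, sub_eq_zero, eq_comm]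
  simp [Matrix.scalar_apply, ← Matrix.smul_one_eq_diagonal, Matrix.smul_mulVec]

lemma root_bound {n : Type*} [Fintype n] [DecidableEq n] (K : Matrix n n ℂ) (S : ℝ)
    (hK : ∀ i, ∑ j, ‖K i j‖ ≤ S) (μ : ℂ) (h : K.charpoly.IsRoot μ) : ‖μ‖ ≤ S := by
  obtain ⟨v, hv, he⟩ := (root_iff K μ).1 h
  obtain ⟨i0, hi0⟩ := Function.ne_iff.1 hv
  obtain ⟨i, -, hi⟩ := Finset.exists_max_image Finset.univ (fun i => ‖v i‖) ⟨i0, Finset.mem_univ _⟩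
  have hpos : 0 < ‖v i‖ := lt_of_lt_of_le (norm_pos_iff.2 hi0) (hi i0 (Finset.mem_univ _))
  have h1 : ‖μ‖ * ‖v i‖ ≤ S * ‖v i‖ := by
    have := congrFun he i
    rw [Pi.smul_apply, smul_eq_mul] at this
    rw [← norm_mul, ← this]
    calc ‖∑ j, K i j * v j‖ ≤ ∑ j, ‖K i j * v j‖ := norm_sum_le _ _
      _ ≤ ∑ j, ‖K i j‖ * ‖v i‖ := by
        refine Finset.sum_le_sum fun j _ => ?_
        rw [norm_mul]
        exact mul_le_mul_of_nonneg_left (hi j (Finset.mem_univ _)) (norm_nonneg _)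
      _ ≤ S * ‖v i‖ := by
        rw [← Finset.sum_mul]
        exact mul_le_mul_of_nonneg_right (hK i) (norm_nonneg _)
  exact le_of_mul_le_mul_right h1 hpos

lemma row_int {d : ℕ} (A : Matrix (Fin d) (Fin d) ℚ) (i j : Fin d) :
    ∃ z : ℤ, ((∏ k, ((A i k).den : ℤ) : ℤ) : ℂ) * ((A i j : ℚ) : ℂ) = z := by
  refine ⟨(∏ k ∈ Finset.univ.erase j, ((A i k).den : ℤ)) * (A i j).num, ?_⟩
  rw [← Finset.prod_erase_mul _ _ (Finset.mem_univ j)]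
  push_cast
  rw [mul_assoc]
  congr 1
  have := Rat.den_mul_eq_num (A i j)
  exact_mod_cast this

/-- Every non-real complex eigenvalue of a `d×d` matrix with rational entries of
bit size at most `b` (with `d ≥ 4`, `b ≥ 1`) has imaginary part of absolute value
at least `4^(-3bd³)`. -/
theorem eigenvalue_im_lower_bound (d b : ℕ) (hd : 4 ≤ d) (hb : 1 ≤ b)
    (A : Matrix (Fin d) (Fin d) ℚ) (hA : ∀ i j, RatBitSizeLE (A i j) b)
    (lam : ℂ) (hlam : (A.map (Rat.cast : ℚ → ℂ)).charpoly.IsRoot lam) (hne : lam.im ≠ 0) :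
    ((4 : ℝ) ^ (3 * b * d ^ 3))⁻¹ ≤ |lam.im| := by
  obtain ⟨v, hv, hev⟩ := (root_iff _ _).1 hlam
  have hev1 : ∀ i, ∑ j, (A i j : ℂ) * v j = lam * v i := fun i => by
    have := congrFun hev i
    simpa [Matrix.mulVec, dotProduct] using this
  have hev2 : ∀ i, ∑ j, (A i j : ℂ) * star (v j) = star lam * star (v i) := fun i => by
    have := congrArg star (hev1 i)
    rw [star_sum] at this
    simpa [mul_comm] using this
  obtain ⟨i0, hi0⟩ := Function.ne_iff.1 hv
  let K : Matrix (Fin d × Fin d) (Fin d × Fin d) ℂ := Matrix.of fun p q =>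
    (if p.2 = q.2 then (A p.1 q.1 : ℂ) else 0) - (if p.1 = q.1 then (A p.2 q.2 : ℂ) else 0)
  let δ : ℂ := lam - star lam
  have hKroot : K.charpoly.IsRoot δ := by
    rw [root_iff]
    refine ⟨fun p => v p.1 * star (v p.2), ?_, ?_⟩
    · refine Function.ne_iff.2 ⟨(i0, i0), ?_⟩
      simpa using hi0
    · ext ⟨i, k⟩
      simp only [Matrix.mulVec, dotProduct, K, Matrix.of_apply, Fintype.sum_prod_type, sub_mul,
        Finset.sum_sub_distrib, ite_mul, zero_mul, Pi.smul_apply, smul_eq_mul, δ]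
      congr 1
      · simp only [Finset.sum_ite_eq, Finset.mem_univ, if_true]
        rw [← mul_assoc, ← hev1 i, Finset.sum_mul]
        simp [mul_assoc]
      · rw [Finset.sum_comm]
        simp only [Finset.sum_ite_eq, Finset.mem_univ, if_true]
        rw [mul_left_comm, ← hev2 k, Finset.mul_sum]
        refine Finset.sum_congr rfl fun j _ => by ring
  have hentry : ∀ i j, ‖(A i j : ℂ)‖ ≤ 2 ^ b := fun i j => by
    have h1 : |A i j| ≤ 2 ^ b := by
      have h2 : |A i j| ≤ |((A i j).num : ℚ)| := by
        conv_lhs => rw [← Rat.num_div_den (A i j)]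
        rw [abs_div]
        refine div_le_self (abs_nonneg _) ?_
        rw [Nat.abs_cast]
        exact_mod_cast (A i j).den_pos
      refine h2.trans ?_
      exact_mod_cast (hA i j).1
    have h3 : ‖(A i j : ℂ)‖ = ((|A i j| : ℚ) : ℝ) := by
      rw [Complex.norm_ratCast]
      push_cast; rfl
    rw [h3]
    exact_mod_cast h1
  have hKrow : ∀ p, ∑ q, ‖K p q‖ ≤ 2 * d * 2 ^ b := by
    rintro ⟨i, k⟩
    calc ∑ q, ‖K (i, k) q‖ ≤ ∑ q : Fin d × Fin d, ((if k = q.2 then (2:ℝ) ^ b else 0) +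
          (if i = q.1 then (2:ℝ) ^ b else 0)) := by
          refine Finset.sum_le_sum fun q _ => ?_
          refine (norm_sub_le _ _).trans (add_le_add ?_ ?_)
          · split_ifs
            · exact hentry _ _
            · simp
          · split_ifs
            · exact hentry _ _
            · simp
      _ = 2 * d * 2 ^ b := by
          rw [Finset.sum_add_distrib, Fintype.sum_prod_type, Fintype.sum_prod_type_right]
          simp
          ring
  let D : Fin d → ℤ := fun i => ∏ k, ((A i k).den : ℤ)
  have hDpos : ∀ i, 0 < D i := fun i => Finset.prod_pos fun k _ => by
    exact_mod_cast (A i k).den_pos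
  have hDle : ∀ i, D i ≤ 2 ^ (b * d) := fun i => by
    calc D i ≤ ∏ k : Fin d, (2 : ℤ) ^ b := Finset.prod_le_prod (fun _ _ => by positivity)
          (fun k _ => by exact_mod_cast (hA i k).2)
      _ = _ := by simp [pow_mul]
  choose z hz using row_int A
  obtain ⟨F, hF⟩ := int_charpoly K (fun p => D p.1 * D p.2)
    (fun p q => (if p.2 = q.2 then D p.2 * z p.1 q.1 else 0) -
      (if p.1 = q.1 then D p.1 * z p.2 q.2 else 0)) (by
    rintro ⟨i, k⟩ ⟨j, l⟩
    have h1 := hz i j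
    have h2 := hz k l
    change (D i : ℂ) * _ = _ at h1
    change (D k : ℂ) * _ = _ at h2
    simp only [K, Matrix.of_apply]
    push_cast
    rw [← h1, ← h2]
    split_ifs <;> ring)
  set c : ℤ := ∏ p : Fin d × Fin d, D p.1 * D p.2 with hc
  have hcpos : 0 < c := Finset.prod_pos fun p _ => mul_pos (hDpos _) (hDpos _)
  have hcle : c ≤ 2 ^ (2 * b * d ^ 3) := by
    calc c ≤ ∏ p : Fin d × Fin d, (2 : ℤ) ^ (2 * b * d) := by
          refine Finset.prod_le_prod (fun p _ => (mul_pos (hDpos _) (hDpos _)).le) fun p _ => ?_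
          calc D p.1 * D p.2 ≤ 2 ^ (b * d) * 2 ^ (b * d) :=
                mul_le_mul (hDle _) (hDle _) (hDpos _).le (by positivity)
            _ = _ := by rw [← pow_add]; congr 1; ring
      _ = _ := by
          simp only [Finset.prod_const, Finset.card_univ, Fintype.card_prod, Fintype.card_fin]
          rw [← pow_mul]; congr 1; ring
  have hsplit := (IsAlgClosed.splits K.charpoly)
  have hprod : K.charpoly = (K.charpoly.roots.map (fun a => Polynomial.X - Polynomial.C a)).prod :=
    hsplit.eq_prod_roots_of_monic K.charpoly_monic
  have hcard : Multiset.card K.charpoly.roots = d * d := by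
    rw [← hsplit.natDegree_eq_card_roots, Matrix.charpoly_natDegree_eq_dim]
    simp
  have hδ0 : δ ≠ 0 := by
    intro h
    have := congrArg Complex.im h
    simp [δ] at this
    exact hne this
  have hδn : ‖δ‖ = 2 * |lam.im| := by
    have : δ = ((2 * lam.im : ℝ) : ℂ) * Complex.I := by
      apply Complex.ext <;> simp [δ]
      ring
    rw [this, norm_mul, Complex.norm_I, mul_one, Complex.norm_real, Real.norm_eq_abs, abs_mul]
    simp
  have hSle : (2 * d * 2 ^ b : ℝ) ≤ 2 ^ (b + 1 + d) := by
    have : (d : ℝ) ≤ 2 ^ d := by exact_mod_cast (Nat.lt_two_pow_self (n := d)).le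
    rw [pow_add, pow_add]
    have h0 : (0:ℝ) ≤ 2 ^ b := by positivity
    nlinarith
  rw [hprod] at hF
  have key := root_lower F (c : ℂ) (by exact_mod_cast hcpos.ne') K.charpoly.roots
    (2 ^ (b + 1 + d)) (one_le_pow₀ (by norm_num))
    (fun a ha => (root_bound K _ hKrow a (Polynomial.isRoot_of_mem_roots ha)).trans hSle)
    hF δ ((Polynomial.mem_roots K.charpoly_monic.ne_zero).2 hKroot) hδ0
  rw [hcard, hδn, Complex.norm_intCast, abs_of_pos (by exact_mod_cast hcpos)] at key
  have hcR : (c : ℝ) ≤ 2 ^ (2 * b * d ^ 3) := by exact_mod_cast hcle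
  rw [inv_le_iff_one_le_mul₀ (by positivity)]
  refine key.trans ?_
  calc (c : ℝ) * (2 * |lam.im| * (2 ^ (b + 1 + d)) ^ (d * d))
      ≤ 2 ^ (2 * b * d ^ 3) * (2 * |lam.im| * (2 ^ (b + 1 + d)) ^ (d * d)) := by gcongr
    _ = |lam.im| * 2 ^ (2 * b * d ^ 3 + (b + 1 + d) * (d * d) + 1) := by
        rw [← pow_mul, pow_succ, pow_add]; ring
    _ ≤ |lam.im| * 2 ^ (2 * (3 * b * d ^ 3)) := by
        gcongr
        · norm_num
        · have h1 : b + 1 + d + 1 ≤ 4 * (b * d) := by nlinarith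
          have h2 : (b + 1 + d + 1) * (d * d) ≤ 4 * (b * d) * (d * d) := by gcongr
          have h3 : 1 ≤ d * d := by nlinarith
          nlinarith
    _ = |lam.im| * 4 ^ (3 * b * d ^ 3) := by rw [pow_mul]; norm_num
end
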